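/- Assume r ≥ 1. Let W ⊆ ((Fin n) → ℝ) × ((Fin m) → ℝ) be open and let T_σ (σ ∈ Fin m) be smooth functions on D^r_W. Assume T is locally variational: every point of W has an open neighborhood W' ⊆ W on which there exists a smooth function L on D^r_{W'} with T_σ = E_σ(L) on D^{2r}_{W'} for all σ ∈ Fin m. Then every point of W has an open neighborhood W'' ⊆ W for which there exist families 𝒯^{I_1…I_s}_{σ; ν_1…ν_s, i_{s+1}…i_n} (0 ≤ s ≤ n, multi-indices I_l of length r−1, σ, ν_l ∈ Fin m, i_j ∈ Fin n) of smooth functions on D^{r−1}_{W''} — alternating-symmetric in the pairs (I_1,ν_1),…,(I_s,ν_s) and in the indices i_{s+1},…,i_n, the index σ playing no role in these symmetries — such that on D^r_{W''}: T_σ = Σ_{s=0}^{n} (1/(s!(n−s)!)) · Σ 𝒯^{I_1…I_s}_{σ; ν_1…ν_s, i_{s+1}…i_n} · 𝒥^{ν_1…ν_s,i_{s+1}…i_n}_{I_1…I_s}, the inner sum running over all ν_1,…,ν_s ∈ Fin m, all multi-indices I_1,…,I_s of length r−1 and all i_{s+1},…,i_n ∈ Fin n. (Locally variational source expressions of order r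 are hyper-Jacobian polynomials in the highest-order derivatives.) -/

import Mathlib

open scoped BigOperators

namespace JetVar

/-- Multi-indices on `Fin n` of degree at most `r`. -/
abbrev MD (n r : ℕ) : Type := {J : Fin n → ℕ // (∑ i, J i) ≤ r}

noncomputable instance (n r : ℕ) : Fintype (MD n r) :=
  Fintype.ofInjective
    (fun J : MD n r => fun i : Fin n =>
      (⟨J.1 i, Nat.lt_succ_of_le ((Finset.single_le_sum
        (fun j _ => Nat.zero_le (J.1 j)) (Finset.mem_univ i)).trans J.2)⟩ : Fin (r+1)))
    (fun _a _b h => Subtype.ext (funext fun i => congrArg Fin.val (congrFun h i)))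

/-- Index set for the `y` coordinates of the `r`-th order jet space. -/
abbrev JIdx (n m r : ℕ) : Type := Fin m × MD n r

/-- The `r`-th order jet coordinate space. -/
abbrev Jet (n m r : ℕ) : Type := ((Fin n) → ℝ) × (JIdx n m r → ℝ)

variable {n m : ℕ}

/-- The coordinate `x^i`. -/
def xc (i : Fin n) {r : ℕ} (p : Jet n m r) : ℝ := p.1 i

/-- The coordinate `y^σ_J` (with the convention that it is `0` for `|J| > r`). -/
def yc (σ : Fin m) (J : Fin n → ℕ) {r : ℕ} (p : Jet n m r) : ℝ :=
  if h : (∑ i, J i) ≤ r then p.2 (σ, ⟨J, h⟩) else 0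

/-- Partial derivative along the coordinate direction `x^i`. -/
noncomputable def pdX (i : Fin n) {r : ℕ} (f : Jet n m r → ℝ) (p : Jet n m r) : ℝ :=
  fderiv ℝ f p (Pi.single i 1, 0)

/-- Partial derivative along the coordinate direction `y^σ_J`
(by convention `0` for `|J| > r`). -/
noncomputable def pdY (σ : Fin m) (J : Fin n → ℕ) {r : ℕ} (f : Jet n m r → ℝ)
    (p : Jet n m r) : ℝ :=
  if h : (∑ i, J i) ≤ r then fderiv ℝ f p (0, Pi.single (σ, (⟨J, h⟩ : MD n r)) 1) else 0

/-- Projection `J^s → J^r` for `r ≤ s`, forgetting higher order coordinates. -/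
def projJet {r s : ℕ} (h : r ≤ s) (p : Jet n m s) : Jet n m r :=
  (p.1, fun q => p.2 (q.1, ⟨q.2.1, q.2.2.trans h⟩))

/-- `J + e_i`. -/
def addE (J : Fin n → ℕ) (i : Fin n) : Fin n → ℕ := fun j => J j + (if j = i then 1 else 0)

/-- `J - e_i` (truncated subtraction). -/
def subE (J : Fin n → ℕ) (i : Fin n) : Fin n → ℕ := fun j => J j - (if j = i then 1 else 0)

/-- The `i`-th formal (total) derivative of a function on `J^r`, a function on `J^{r+1}`. -/
noncomputable def formalD (i : Fin n) {r : ℕ} (f : Jet n m r → ℝ) (p : Jet n m (r+1)) : ℝ :=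
  pdX i f (projJet (Nat.le_succ r) p)
    + ∑ q : JIdx n m r, yc q.1 (addE q.2.1 i) p * pdY q.1 q.2.1 f (projJet (Nat.le_succ r) p)

/-- Iterated formal derivatives along a list of directions. -/
noncomputable def formalDL {r : ℕ} : (l : List (Fin n)) → (Jet n m r → ℝ) →
    (Jet n m (r + l.length) → ℝ)
  | [], f => f
  | i :: l, f => formalD i (formalDL l f)

/-- The canonical list of directions attached to a multi-index
(each `i` repeated `J i` times, in increasing order of `i`). -/
def mlist (J : Fin n → ℕ) : List (Fin n) :=
  (List.finRange n).flatMap (fun i => List.replicate (J i) i)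

lemma mlist_length (J : Fin n → ℕ) : (mlist J).length = ∑ i, J i := by
  rw [mlist, List.length_flatMap]
  simp only [Function.comp_def, List.length_replicate]
  rw [Fin.sum_univ_def]

/-- The iterated formal derivative `d_I`, applying each `d_i` exactly `I i` times
(in increasing order of `i`); a function on `J^{r+|I|}`. -/
noncomputable def formalDI (I : Fin n → ℕ) {r : ℕ} (f : Jet n m r → ℝ)
    (p : Jet n m (r + ∑ i, I i)) : ℝ :=
  formalDL (mlist I) f (projJet (le_of_eq (by rw [mlist_length])) p)

/-- The Lie–Euler expression `E^I_σ(L)` of a function `L` on `J^r`, a function on `J^{2r}`. -/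
noncomputable def LieEuler {r : ℕ} (σ : Fin m) (I : Fin n → ℕ) (L : Jet n m r → ℝ)
    (p : Jet n m (2*r)) : ℝ :=
  ∑ J : MD n r,
    if h : (∑ i, (I i + J.1 i)) ≤ r then
      (-1:ℝ)^(∑ i, J.1 i) * (∏ i, (Nat.choose (I i + J.1 i) (I i) : ℝ)) *
        formalDI J.1 (pdY σ (fun i => I i + J.1 i) L)
          (projJet (by have := J.2; omega) p)
    else 0

/-- The Euler–Lagrange expression `E_σ(L)`. -/
noncomputable def EL {r : ℕ} (σ : Fin m) (L : Jet n m r → ℝ) : Jet n m (2*r) → ℝ :=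
  LieEuler σ (fun _ => 0) L


/-- The sign of a tuple `(i_1,…,i_n)` as a permutation of `Fin n`
(`0` if two entries coincide). -/
noncomputable def epsSign {n : ℕ} (v : Fin n → Fin n) : ℝ :=
  if h : Function.Bijective v then ((Equiv.Perm.sign (Equiv.ofBijective v h) : ℤ) : ℝ) else 0

/-- The hyper-Jacobian `𝒥^{σ_1…σ_s, i_{s+1}…i_n}_{I_1…I_s}`, a function on `J^r`. -/
noncomputable def hyperJ {n m : ℕ} {r : ℕ} (s : ℕ) (hs : s ≤ n)
    (I : Fin s → (Fin n → ℕ)) (σs : Fin s → Fin m) (iv : Fin (n - s) → Fin n)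
    (p : Jet n m r) : ℝ :=
  ∑ w : Fin s → Fin n,
    epsSign (fun a : Fin n => Fin.append w iv (Fin.cast (by omega) a)) *
      ∏ l : Fin s, yc (σs l) (addE (I l) (w l)) p

/-- The truncated formal derivative `δ_i` on functions on `J^t`
(summing only over `|J| ≤ t − 1`). -/
noncomputable def truncD {n m : ℕ} {t : ℕ} (i : Fin n) (f : Jet n m t → ℝ)
    (p : Jet n m t) : ℝ :=
  pdX i f p + ∑ q : JIdx n m (t-1), yc q.1 (addE q.2.1 i) p * pdY q.1 q.2.1 f p

/-- Deleting the `k`-th entry of a tuple. -/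
def delTup {α : Type*} {s : ℕ} (k : Fin s) (f : Fin s → α) : Fin (s-1) → α :=
  fun j =>
    if h : (j : ℕ) < (k : ℕ) then f ⟨j, by have := j.isLt; omega⟩
    else f ⟨(j : ℕ) + 1, by have := j.isLt; omega⟩

/-- The type of families `A^{I_1…I_s}_{σ_1…σ_s, i_{s+1}…i_{n−1}}` of functions on
`J^{r−1}` (with `s` pairs and `n − s − 1` indices in `Fin n`). -/
def JetFam (n m r : ℕ) : Type :=
  (s : ℕ) → (Fin s → (Fin n → ℕ)) → (Fin s → Fin m) → (Fin (n - s - 1) → Fin n) →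
    Jet n m (r-1) → ℝ

/-- Alternating-symmetry of a family: any simultaneous permutation of the pairs and any
permutation of the `Fin n` indices multiplies it by the sign of the permutation. -/
def IsAltSym {n m r : ℕ} (A : JetFam n m r) : Prop :=
  ∀ (s : ℕ) (τ : Equiv.Perm (Fin s)) (ρ : Equiv.Perm (Fin (n - s - 1)))
    (I : Fin s → (Fin n → ℕ)) (σs : Fin s → Fin m) (iv : Fin (n - s - 1) → Fin n)
    (p : Jet n m (r-1)),
    A s (I ∘ τ) (σs ∘ τ) (iv ∘ ρ) p
      = ((Equiv.Perm.sign τ : ℤ) : ℝ) * ((Equiv.Perm.sign ρ : ℤ) : ℝ) * A s I σs iv p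

/-- The coefficients `ℒ^{I_1…I_s}_{σ_1…σ_s, i_{s+1}…i_n}` associated to a family `A`. -/
noncomputable def Lcoef {n m r : ℕ} (A : JetFam n m r) (s : ℕ)
    (I : Fin s → (Fin n → ℕ)) (σs : Fin s → Fin m) (iv : Fin (n - s) → Fin n)
    (p : Jet n m (r-1)) : ℝ :=
  (∑ k : Fin s, (-1:ℝ)^(k:ℕ) *
      pdY (σs k) (I k)
        (A (s-1) (delTup k I) (delTup k σs)
          (fun j : Fin (n - (s-1) - 1) =>
            iv (Fin.cast (by have := k.isLt; omega : n - (s-1) - 1 = n - s) j))) p)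
  + (∑ k : Fin (n - s), (-1:ℝ)^((s:ℕ) + (k:ℕ)) *
      truncD (iv k) (A s I σs (delTup k iv)) p)

/-- The type of coefficient families `C^{I_1…I_s}_{σ_1…σ_s, i_{s+1}…i_n}` of functions
on `J^{r−1}` (with `s` pairs and `n − s` indices in `Fin n`). -/
def CoefFam (n m r : ℕ) : Type :=
  (s : ℕ) → (Fin s → (Fin n → ℕ)) → (Fin s → Fin m) → (Fin (n - s) → Fin n) →
    Jet n m (r-1) → ℝ

/-- Alternating-symmetry for coefficient families. -/
def IsAltSymC {n m r : ℕ} (C : CoefFam n m r) : Prop :=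
  ∀ (s : ℕ) (τ : Equiv.Perm (Fin s)) (ρ : Equiv.Perm (Fin (n - s)))
    (I : Fin s → (Fin n → ℕ)) (σs : Fin s → Fin m) (iv : Fin (n - s) → Fin n)
    (p : Jet n m (r-1)),
    C s (I ∘ τ) (σs ∘ τ) (iv ∘ ρ) p
      = ((Equiv.Perm.sign τ : ℤ) : ℝ) * ((Equiv.Perm.sign ρ : ℤ) : ℝ) * C s I σs iv p

/-- The Lagrangian on `J^r` associated to a coefficient family, a hyper-Jacobian
polynomial in the highest-order derivatives. -/
noncomputable def LagC {n m r : ℕ} (C : CoefFam n m r) (p : Jet n m r) : ℝ :=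
  ∑ s : Fin (n+1),
    (((s:ℕ).factorial * (n - (s:ℕ)).factorial : ℕ) : ℝ)⁻¹ *
      ∑ I : Fin (s:ℕ) → MD n (r-1), ∑ σs : Fin (s:ℕ) → Fin m,
        ∑ iv : Fin (n - (s:ℕ)) → Fin n,
          (if ∀ l, (∑ i, (I l).1 i) = r - 1 then (1:ℝ) else 0) *
            C (s:ℕ) (fun l => (I l).1) σs iv (projJet (Nat.sub_le r 1) p) *
            hyperJ (s:ℕ) (by have := s.isLt; omega) (fun l => (I l).1) σs iv p

/-- The Lagrangian `L_A` associated to a family `A`. -/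
noncomputable def LagA {n m r : ℕ} (A : JetFam n m r) : Jet n m r → ℝ :=
  LagC (fun s I σs iv => Lcoef A s I σs iv)

/-- The open subset `D^t_W` of `J^t` lying over an open set `W` of the total space. -/
def Dset {n m : ℕ} (t : ℕ) (W : Set (((Fin n) → ℝ) × ((Fin m) → ℝ))) :
    Set (Jet n m t) :=
  {p | (p.1, fun σ => yc σ (fun _ => 0) p) ∈ W}

end JetVar


namespace JetVar
open MvPolynomial

/-- Polarisation derivation `E_ij`. -/
noncomputable def pol {s n : ℕ} (i j : Fin s) :
    Derivation ℝ (MvPolynomial (Fin s × Fin n) ℝ) (MvPolynomial (Fin s × Fin n) ℝ) :=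
  ∑ a : Fin n, (X (i, a) : MvPolynomial (Fin s × Fin n) ℝ) • pderiv (j, a)

lemma pol_apply {s n : ℕ} (i j : Fin s) (P : MvPolynomial (Fin s × Fin n) ℝ) :
    pol i j P = ∑ a : Fin n, X (i, a) * pderiv (j, a) P := by
  have h := map_sum (Derivation.coeFnAddMonoidHom :
    Derivation ℝ (MvPolynomial (Fin s × Fin n) ℝ) (MvPolynomial (Fin s × Fin n) ℝ) →+ _)
    (fun a : Fin n => (X (i, a) : MvPolynomial (Fin s × Fin n) ℝ) • pderiv (j, a)) Finset.univ
  have h2 := congrFun h P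
  rw [Finset.sum_apply] at h2
  exact h2

lemma pol_X {s n : ℕ} (i j k : Fin s) (a : Fin n) :
    pol i j (X (k, a) : MvPolynomial (Fin s × Fin n) ℝ) = if k = j then X (i, a) else 0 := by
  rw [pol_apply]
  split_ifs with h
  · subst h
    rw [Finset.sum_eq_single a]
    · simp
    · intro b _ hb
      rw [pderiv_X_of_ne (by simpa using hb.symm), mul_zero]
    · simp
  · apply Finset.sum_eq_zero
    intro b _
    rw [pderiv_X_of_ne (by simp [h]), mul_zero]

lemma pd_comm {κ : Type*} (a b : κ) (P : MvPolynomial κ ℝ) :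
    pderiv a (pderiv b P) = pderiv b (pderiv a P) := by
  classical
  have h : (⁅(pderiv a : Derivation ℝ (MvPolynomial κ ℝ) (MvPolynomial κ ℝ)),
      (pderiv b : Derivation ℝ (MvPolynomial κ ℝ) (MvPolynomial κ ℝ))⁆) = 0 := by
    apply MvPolynomial.derivation_ext
    intro c
    simp [Derivation.commutator_apply, pderiv_X, Pi.single_apply]
    split_ifs <;> simp
  have := congrArg (fun D => D P) h
  simpa [Derivation.commutator_apply, sub_eq_zero] using this

lemma pderiv_pol {s n : ℕ} (u v k : Fin s) (b : Fin n) (P : MvPolynomial (Fin s × Fin n) ℝ) :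
    pderiv (k, b) (pol u v P)
      = pol u v (pderiv (k, b) P) + if k = u then pderiv (v, b) P else 0 := by
  rw [pol_apply, pol_apply, map_sum]
  simp only [Derivation.leibniz, smul_eq_mul, Finset.sum_add_distrib]
  congr 1
  · exact Finset.sum_congr rfl fun a _ => by rw [pd_comm]
  · split_ifs with h
    · subst h
      rw [Finset.sum_eq_single b]
      · simp
      · intro c _ hc
        rw [pderiv_X_of_ne (by simpa using hc), mul_zero]
      · simp
    · apply Finset.sum_eq_zero
      intro c _
      rw [pderiv_X_of_ne (by simpa using fun h' => absurd h'.symm h), mul_zero]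

/-- Normally ordered product of polarisation operators. -/
noncomputable def nrmL {s n : ℕ} : List (Fin s × Fin s) →
    (MvPolynomial (Fin s × Fin n) ℝ →ₗ[ℝ] MvPolynomial (Fin s × Fin n) ℝ)
  | [] => LinearMap.id
  | q :: l => ∑ a : Fin n, (LinearMap.mulLeft ℝ (X (q.1, a))) ∘ₗ (nrmL l) ∘ₗ
      (pderiv (q.2, a) : Derivation ℝ (MvPolynomial (Fin s × Fin n) ℝ) _).toLinearMap

lemma nrmL_cons {s n : ℕ} (q : Fin s × Fin s) (l : List (Fin s × Fin s))
    (P : MvPolynomial (Fin s × Fin n) ℝ) :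
    nrmL (q :: l) P = ∑ a : Fin n, X (q.1, a) * nrmL l (pderiv (q.2, a) P) := by
  simp [nrmL]

lemma nrmL_perm {s n : ℕ} {l l' : List (Fin s × Fin s)} (h : l.Perm l') :
    ∀ (P : MvPolynomial (Fin s × Fin n) ℝ), nrmL l P = nrmL l' P := by
  induction h with
  | nil => intro P; rfl
  | cons x _ ih => intro P; simp only [nrmL_cons, ih]
  | swap x y l =>
    intro P
    simp only [nrmL_cons, Finset.mul_sum]
    rw [Finset.sum_comm]
    refine Finset.sum_congr rfl fun a _ => Finset.sum_congr rfl fun b _ => ?_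
    rw [pd_comm, mul_left_comm]
  | trans _ _ ih1 ih2 => intro P; rw [ih1, ih2]

/-- Normally ordered product indexed by `Fin k`. -/
noncomputable def nrm {s n k : ℕ} (i j : Fin k → Fin s) :
    (MvPolynomial (Fin s × Fin n) ℝ →ₗ[ℝ] MvPolynomial (Fin s × Fin n) ℝ) :=
  nrmL (List.ofFn fun l => (i l, j l))

lemma nrm_zero {s n : ℕ} (i j : Fin 0 → Fin s) (P : MvPolynomial (Fin s × Fin n) ℝ) :
    nrm i j P = P := by
  simp [nrm, nrmL]

lemma nrm_succ {s n k : ℕ} (i j : Fin (k+1) → Fin s) (P : MvPolynomial (Fin s × Fin n) ℝ) :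
    nrm i j P = ∑ a : Fin n, X (i 0, a) *
      nrm (fun l => i l.succ) (fun l => j l.succ) (pderiv (j 0, a) P) := by
  simp [nrm, List.ofFn_succ, nrmL_cons]

lemma nrm_comp_perm {s n k : ℕ} (i j : Fin k → Fin s) (π : Equiv.Perm (Fin k))
    (P : MvPolynomial (Fin s × Fin n) ℝ) :
    nrm (i ∘ π) (j ∘ π) P = nrm i j P :=
  nrmL_perm (π.ofFn_comp_perm (fun l => (i l, j l))) P

lemma nrm_pol {s n : ℕ} (u v : Fin s) : ∀ {k : ℕ} (i j : Fin k → Fin s)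
    (P : MvPolynomial (Fin s × Fin n) ℝ),
    nrm i j (pol u v P) = ∑ a : Fin n, X (u, a) * nrm i j (pderiv (v, a) P)
      + ∑ l, if j l = u then nrm i (Function.update j l v) P else 0 := by
  intro k
  induction k with
  | zero => intro i j P; simp [nrm_zero, pol_apply]
  | succ k ih =>
    intro i j P
    rw [nrm_succ]
    simp only [pderiv_pol, map_add, ih, mul_add, Finset.sum_add_distrib]
    rw [Fin.sum_univ_succ, add_assoc]
    congr 1
    · simp only [nrm_succ i j, Finset.mul_sum]
      rw [Finset.sum_comm]
      refine Finset.sum_congr rfl fun a _ => Finset.sum_congr rfl fun b _ => ?_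
      rw [pd_comm, mul_left_comm]
    · rw [add_comm]
      congr 1
      · split_ifs with h
        · rw [nrm_succ]
          simp
        · simp
      · simp only [Finset.mul_sum]
        rw [Finset.sum_comm]
        refine Finset.sum_congr rfl fun l _ => ?_
        split_ifs with h
        · rw [nrm_succ]
          refine Finset.sum_congr rfl fun b _ => ?_
          congr 2
          · congr 1
            ext x
            simp [Function.update_apply]
        · simp

lemma nrm_succ' {s n k : ℕ} (i j : Fin (k+1) → Fin s) (P : MvPolynomial (Fin s × Fin n) ℝ) :
    nrm i j P = nrm (fun l => i l.succ) (fun l => j l.succ) (pol (i 0) (j 0) P)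
      - ∑ l : Fin k, if j l.succ = i 0 then
        nrm (fun l => i l.succ) (Function.update (fun l => j l.succ) l (j 0)) P else 0 := by
  rw [nrm_pol, nrm_succ]; ring

/-- The minor of the generic matrix with columns `a`. -/
noncomputable def minr {s n : ℕ} (a : Fin s → Fin n) : MvPolynomial (Fin s × Fin n) ℝ :=
  ∑ w : Equiv.Perm (Fin s), ((Equiv.Perm.sign w : ℤ) : ℝ) • ∏ l, X (w l, a l)

lemma minr_eq_det {s n : ℕ} (a : Fin s → Fin n) :
    minr a = Matrix.det (Matrix.of fun (l k : Fin s) =>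
      (X (l, a k) : MvPolynomial (Fin s × Fin n) ℝ)) := by
  rw [Matrix.det_apply, minr]
  refine Finset.sum_congr rfl fun w _ => ?_
  rw [Units.smul_def, ← Int.cast_smul_eq_zsmul ℝ]
  rfl

/-- The ideal of maximal minors. -/
noncomputable def minI (s n : ℕ) : Ideal (MvPolynomial (Fin s × Fin n) ℝ) :=
  Ideal.span (Set.range (minr (s := s) (n := n)))

lemma deriv_prod_aux {A ι : Type*} [CommRing A] [Algebra ℝ A] [DecidableEq ι]
    (D : Derivation ℝ A A) (S : Finset ι) (f : ι → A) :
    D (∏ l ∈ S, f l) = ∑ l ∈ S, (∏ k ∈ S.erase l, f k) • D (f l) := by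
  induction S using Finset.induction_on with
  | empty => simp
  | insert x S hx ih =>
    rw [Finset.prod_insert hx, Derivation.leibniz, ih, Finset.sum_insert hx,
      Finset.erase_insert hx, add_comm]
    congr 1
    rw [Finset.smul_sum]
    refine Finset.sum_congr rfl fun l hl => ?_
    have hne : x ≠ l := fun h => hx (h ▸ hl)
    rw [Finset.erase_insert_of_ne hne, Finset.prod_insert (by simp [hx]), smul_smul]

lemma pol_prod {s n : ℕ} (i j : Fin s) (a : Fin s → Fin n) (w : Equiv.Perm (Fin s)) :
    pol i j (∏ l, (X (w l, a l) : MvPolynomial (Fin s × Fin n) ℝ))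
      = ∏ l, X (if w l = j then i else w l, a l) := by
  classical
  rw [deriv_prod_aux]
  simp only [pol_X, smul_eq_mul]
  rw [Finset.sum_eq_single (w.symm j)]
  · rw [← Finset.prod_erase_mul _ _ (Finset.mem_univ (w.symm j))]
    simp only [Equiv.apply_symm_apply, if_true]
    congr 1
    refine Finset.prod_congr rfl fun l hl => ?_
    rw [if_neg]
    intro h
    exact (Finset.mem_erase.1 hl).1 (by rw [← h]; simp)
  · intro b _ hb
    rw [if_neg, mul_zero]
    intro h
    exact hb (by rw [← h]; simp)
  · simp

lemma pol_minr {s n : ℕ} (i j : Fin s) (a : Fin s → Fin n) :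
    pol i j (minr a) ∈ minI s n := by
  have h1 : pol i j (minr a) = Matrix.det (Matrix.of fun (l k : Fin s) =>
      (X (if l = j then i else l, a k) : MvPolynomial (Fin s × Fin n) ℝ)) := by
    rw [Matrix.det_apply, minr, map_sum]
    refine Finset.sum_congr rfl fun w _ => ?_
    rw [Units.smul_def, ← Int.cast_smul_eq_zsmul ℝ, Derivation.map_smul, pol_prod]
    rfl
  by_cases h : i = j
  · subst h
    have : pol i i (minr a) = minr a := by
      rw [h1, minr_eq_det]
      congr 1
      ext l k : 2
      simp only [Matrix.of_apply]
      split_ifs with h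
      · rw [h]
      · rfl
    rw [this]
    exact Ideal.subset_span ⟨a, rfl⟩
  · rw [h1, Matrix.det_zero_of_row_eq h]
    · exact zero_mem _
    · ext k : 1
      simp

lemma pol_mem {s n : ℕ} (i j : Fin s) {P : MvPolynomial (Fin s × Fin n) ℝ}
    (hP : P ∈ minI s n) : pol i j P ∈ minI s n := by
  refine Submodule.span_induction ?_ ?_ ?_ ?_ hP
  · rintro _ ⟨a, rfl⟩; exact pol_minr i j a
  · simp
  · intro x y _ _ hx hy; rw [map_add]; exact add_mem hx hy
  · intro c x hx' hx
    rw [smul_eq_mul, Derivation.leibniz]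
    exact add_mem (Ideal.mul_mem_left _ _ hx) (Ideal.mul_mem_right _ _ hx')

lemma rsmul_mem {s n : ℕ} {P : MvPolynomial (Fin s × Fin n) ℝ} (c : ℝ)
    (hP : P ∈ minI s n) : c • P ∈ minI s n := by
  rw [MvPolynomial.smul_eq_C_mul]; exact Ideal.mul_mem_left _ _ hP

lemma nrm_mem {s n : ℕ} : ∀ {k : ℕ} (i j : Fin k → Fin s) {P : MvPolynomial (Fin s × Fin n) ℝ},
    P ∈ minI s n → nrm i j P ∈ minI s n := by
  intro k
  induction k with
  | zero => intro i j P hP; rwa [nrm_zero]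
  | succ k ih =>
    intro i j P hP
    rw [nrm_succ']
    refine sub_mem (ih _ _ (pol_mem _ _ hP)) (sum_mem fun l _ => ?_)
    split_ifs
    · exact ih _ _ hP
    · exact zero_mem _

/-- Antisymmetrised normally ordered product. -/
noncomputable def capT {s n k : ℕ} (u : Fin k → Fin s) (P : MvPolynomial (Fin s × Fin n) ℝ) :
    MvPolynomial (Fin s × Fin n) ℝ :=
  ∑ w : Equiv.Perm (Fin k), ((Equiv.Perm.sign w : ℤ) : ℝ) • nrm (u ∘ w) u P

lemma capT_comp {s n k : ℕ} (u : Fin k → Fin s) (π : Equiv.Perm (Fin k))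
    (P : MvPolynomial (Fin s × Fin n) ℝ) : capT (u ∘ π) P = capT u P := by
  unfold capT
  refine Fintype.sum_equiv (MulAut.conj π).toEquiv _ _ fun w => ?_
  have h1 : (u ∘ π) ∘ w = (u ∘ ⇑((MulAut.conj π).toEquiv w)) ∘ π := by
    ext l; simp [MulAut.conj_apply]
  rw [h1, nrm_comp_perm]
  congr 3
  simp [MulAut.conj_apply, mul_comm]
  rw [← mul_assoc, Int.units_mul_self, one_mul]

lemma nrm_expand {s n : ℕ} : ∀ {k : ℕ} (i j : Fin k → Fin s) (P : MvPolynomial (Fin s × Fin n) ℝ),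
    nrm i j P = ∑ a : Fin k → Fin n, (∏ l, X (i l, a l)) *
      ((List.ofFn fun l => (j l, a l)).foldl (fun Q q => pderiv q Q) P) := by
  intro k
  induction k with
  | zero => intro i j P; simp [nrm_zero]
  | succ k ih =>
    intro i j P
    rw [nrm_succ, ← (Fin.consEquiv (fun _ => Fin n)).sum_comp, Fintype.sum_prod_type]
    refine Finset.sum_congr rfl fun a _ => ?_
    rw [ih, Finset.mul_sum]
    refine Finset.sum_congr rfl fun b _ => ?_
    rw [Fin.prod_univ_succ, List.ofFn_succ, List.foldl_cons]
    simp [Fin.consEquiv, mul_assoc]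

lemma capT_id_mem {s n : ℕ} (P : MvPolynomial (Fin s × Fin n) ℝ) :
    capT (id : Fin s → Fin s) P ∈ minI s n := by
  have : capT (id : Fin s → Fin s) P = ∑ a : Fin s → Fin n, minr a *
      ((List.ofFn fun l => (l, a l)).foldl (fun Q q => pderiv q Q) P) := by
    unfold capT minr
    simp only [nrm_expand, Finset.smul_sum, Finset.sum_mul]
    rw [Finset.sum_comm]
    simp
  rw [this]
  exact sum_mem fun a _ => Ideal.mul_mem_right _ _ (Ideal.subset_span ⟨a, rfl⟩)

lemma capT_succ {s n k : ℕ} (u : Fin (k+1) → Fin s) (hu : Function.Injective u)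
    (P : MvPolynomial (Fin s × Fin n) ℝ)
    (hE : ∀ q : Fin k, pol (u q.succ) (u 0) P ∈ minI s n) (c : ℝ)
    (h0 : pol (u 0) (u 0) P = c • P) :
    capT u P - (c • capT (fun l => u l.succ) P
      + ∑ q : Fin k, capT (fun l : Fin k => u (Equiv.swap 0 q.succ l.succ)) P) ∈ minI s n := by
  have key : capT u P = (c • capT (fun l => u l.succ) P
      + ∑ q : Fin k, capT (fun l : Fin k => u (Equiv.swap 0 q.succ l.succ)) P)
      - ∑ q : Fin k, ∑ e : Equiv.Perm (Fin k), ((Equiv.Perm.sign e : ℤ) : ℝ) •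
          nrm (fun l => u (Equiv.swap 0 q.succ (e l).succ)) (fun l => u l.succ)
            (pol (u q.succ) (u 0) P) := by
    rw [add_sub_assoc, ← Finset.sum_sub_distrib]
    conv_lhs => rw [capT, ← Equiv.Perm.decomposeFin.symm.sum_comp, Fintype.sum_prod_type,
      Fin.sum_univ_succ]
    congr 1
    · rw [capT, Finset.smul_sum]
      refine Finset.sum_congr rfl fun e _ => ?_
      rw [nrm_succ', Finset.sum_eq_zero, sub_zero]
      · simp only [Function.comp_apply, Equiv.Perm.decomposeFin_symm_apply_zero, h0,
          Equiv.Perm.decomposeFin_symm_apply_succ, Equiv.Perm.decomposeFin.symm_sign]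
        simp only [if_true, one_mul, Equiv.swap_self, Equiv.refl_apply, map_smul]
        rw [smul_comm]
        rfl
      · intro l _
        rw [if_neg]
        simp only [Function.comp_apply, Equiv.Perm.decomposeFin_symm_apply_zero]
        intro h
        exact Fin.succ_ne_zero l (hu h)
    · refine Finset.sum_congr rfl fun q _ => ?_
      rw [capT, ← Finset.sum_sub_distrib]
      refine Finset.sum_congr rfl fun e _ => ?_
      rw [nrm_succ', Finset.sum_eq_single q]
      · simp only [Function.comp_apply, Equiv.Perm.decomposeFin_symm_apply_zero,
          Equiv.Perm.decomposeFin_symm_apply_succ, Equiv.Perm.decomposeFin.symm_sign, if_true]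
        rw [if_neg (Fin.succ_ne_zero q), ← smul_sub]
        have : Function.update (fun l : Fin k => u l.succ) q (u 0)
            = fun l : Fin k => u (Equiv.swap 0 q.succ l.succ) := by
          ext l
          by_cases h : l = q
          · subst h; simp
          · rw [Function.update_of_ne h, Equiv.swap_apply_of_ne_of_ne (Fin.succ_ne_zero l)]
            simpa using h
        rw [this]
        simp only [neg_mul, one_mul, Units.val_neg, Int.cast_neg, neg_smul, Function.comp_def]
        rw [← smul_neg, neg_sub]
      · intro l _ hl
        rw [if_neg]
        simp only [Function.comp_apply, Equiv.Perm.decomposeFin_symm_apply_zero]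
        intro h
        exact hl (Fin.succ_injective _ (hu h))
      · simp
  rw [key, sub_sub_cancel_left]
  refine neg_mem (sum_mem fun q _ => sum_mem fun e _ => rsmul_mem _ (nrm_mem _ _ (hE q)))

lemma capT_scalar {s n : ℕ} (P : MvPolynomial (Fin (s+1) × Fin n) ℝ) (lam : Fin (s+1) → ℕ)
    (hE : ∀ i j : Fin (s+1), i < j → pol i j P ∈ minI (s+1) n)
    (hlam : ∀ i, pol i i P = (lam i : ℝ) • P) (hl : 0 < lam (Fin.last s)) :
    ∀ {k : ℕ} (u : Fin k → Fin (s+1)), Function.Injective u →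
      ∃ c : ℝ, 0 ≤ c ∧ capT u P - c • P ∈ minI (s+1) n ∧
        ((∃ l, u l = Fin.last s) → 0 < c) ∧ (k = 0 → c = 1) := by
  intro k
  induction k with
  | zero =>
    intro u hu
    refine ⟨1, zero_le_one, ?_, fun _ => one_pos, fun _ => rfl⟩
    simp [capT, nrm_zero]
  | succ k ih =>
    intro u' hu'
    obtain ⟨l0, hl0⟩ := Finite.exists_max u'
    set u := u' ∘ Equiv.swap 0 l0 with hudef
    have hu : Function.Injective u := hu'.comp (Equiv.injective _)
    have hmax : ∀ l, u l ≤ u 0 := by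
      intro l
      simp only [hudef, Function.comp_apply, Equiv.swap_apply_left]
      exact hl0 _
    obtain ⟨c0, hc0, hm0, -, hk0⟩ := ih (fun l => u l.succ)
      (hu.comp (Fin.succ_injective _))
    have H : ∀ q : Fin k, ∃ c : ℝ, 0 ≤ c ∧
        capT (fun l : Fin k => u (Equiv.swap 0 q.succ l.succ)) P - c • P ∈ minI (s+1) n ∧
        ((∃ l : Fin k, u (Equiv.swap 0 q.succ l.succ) = Fin.last s) → 0 < c) := by
      intro q
      obtain ⟨c, h1, h2, h3, -⟩ := ih (fun l : Fin k => u (Equiv.swap 0 q.succ l.succ))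
        (hu.comp ((Equiv.injective _).comp (Fin.succ_injective _)))
      exact ⟨c, h1, h2, h3⟩
    choose c hc hm hp using H
    refine ⟨lam (u 0) * c0 + ∑ q, c q, ?_, ?_, ?_, ?_⟩
    · exact add_nonneg (mul_nonneg (Nat.cast_nonneg _) hc0) (Finset.sum_nonneg fun q _ => hc q)
    · rw [← capT_comp u' (Equiv.swap 0 l0), ← hudef]
      have h1 := capT_succ u hu P (fun q => hE _ _ (lt_of_le_of_ne (hmax _)
        (fun h => Fin.succ_ne_zero q (hu h)))) (lam (u 0)) (hlam _)
      have h2 := add_mem (add_mem h1 (rsmul_mem (lam (u 0) : ℝ) hm0))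
        (sum_mem fun q (_ : q ∈ Finset.univ) => hm q)
      convert h2 using 1
      rw [Finset.sum_sub_distrib, add_smul, Finset.sum_smul, smul_sub, mul_smul]
      abel
    · rintro ⟨l, hl'⟩
      have h0 : u 0 = Fin.last s := by
        apply le_antisymm (Fin.le_last _)
        rw [← hl']
        simp only [hudef, Function.comp_apply, Equiv.swap_apply_left]
        exact hl0 _
      rcases Nat.eq_zero_or_pos k with hk | hk
      · subst hk
        rw [hk0 rfl, h0]
        simpa using hl
      · refine add_pos_of_nonneg_of_pos (mul_nonneg (Nat.cast_nonneg _) hc0)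
          (Finset.sum_pos (fun q _ => hp q ⟨q, ?_⟩) ⟨⟨0, hk⟩, Finset.mem_univ _⟩)
        rw [Equiv.swap_apply_right, h0]
    · intro h; omega

end JetVar


namespace JetVar
open MvPolynomial

/-- Polynomials vanishing on all matrices whose rows satisfy a linear relation with all
coefficients nonzero. -/
def VanRel {s n : ℕ} (P : MvPolynomial (Fin s × Fin n) ℝ) : Prop :=
  ∀ (ξ : Fin s → Fin n → ℝ) (t : Fin s → ℝ), (∀ l, t l ≠ 0) → (∑ l, t l • ξ l = 0) →
    eval (fun q => ξ q.1 q.2) P = 0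

lemma hasDerivAt_eval {κ : Type*} [Fintype κ] (x y : κ → ℝ) (P : MvPolynomial κ ℝ) (t : ℝ) :
    HasDerivAt (fun t : ℝ => eval (fun k => x k + t * y k) P)
      (∑ k, y k * eval (fun k => x k + t * y k) (pderiv k P)) t := by
  classical
  induction P using MvPolynomial.induction_on with
  | C a => simpa using hasDerivAt_const t a
  | add p q hp hq =>
    simp only [map_add, mul_add, Finset.sum_add_distrib]
    exact hp.add hq
  | mul_X p i hp =>
    have h1 : HasDerivAt (fun t : ℝ => x i + t * y i) (y i) t := by
      simpa using ((hasDerivAt_id t).mul_const (y i)).const_add (x i)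
    have h2 := hp.mul h1
    simp only [map_mul, eval_X]
    refine HasDerivAt.congr_deriv h2 ?_
    symm
    simp only [Derivation.leibniz, smul_eq_mul, map_add, map_mul, eval_X, pderiv_X,
      Pi.single_apply, mul_add, Finset.sum_add_distrib]
    rw [add_comm]
    congr 1
    · rw [← mul_add, Finset.sum_mul]
      exact Finset.sum_congr rfl fun k _ => by ring
    · rw [Finset.sum_eq_single i]
      · simp; ring
      · intro b _ hb; simp [hb.symm]
      · simp

lemma VanRel.pol {s n : ℕ} {P : MvPolynomial (Fin s × Fin n) ℝ} (h : VanRel P) {i j : Fin s}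
    (hij : i ≠ j) : VanRel (pol i j P) := by
  classical
  intro ξ t ht hrel
  have h1 := hasDerivAt_eval (fun q : Fin s × Fin n => ξ q.1 q.2)
    (fun q => if q.1 = j then ξ i q.2 else 0) P 0
  have h2 : ∀ᶠ ε in nhds (0:ℝ), eval (fun q : Fin s × Fin n =>
      ξ q.1 q.2 + ε * (if q.1 = j then ξ i q.2 else 0)) P = 0 := by
    have h3 : ∀ᶠ ε in nhds (0:ℝ), t i - ε * t j ≠ 0 := by
      have hc : ContinuousAt (fun ε : ℝ => t i - ε * t j) 0 := by fun_prop
      apply hc.eventually_ne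
      simpa using ht i
    filter_upwards [h3] with ε hε
    have := h (fun l a => ξ l a + ε * (if l = j then ξ i a else 0))
      (Function.update t i (t i - ε * t j)) ?_ ?_
    · exact this
    · intro l
      by_cases hl : l = i
      · subst hl; simpa using hε
      · simpa [Function.update_of_ne hl] using ht l
    · ext a
      have hr := congrFun hrel a
      simp only [Finset.sum_apply, Pi.smul_apply, smul_eq_mul, Pi.zero_apply] at hr ⊢
      have e1 : ∀ l, Function.update t i (t i - ε * t j) l *
          (ξ l a + ε * (if l = j then ξ i a else 0)) = t l * ξ l a
          + (if l = j then t j * ε * ξ i a else 0) - (if l = i then ε * t j * ξ i a else 0) := by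
        intro l
        by_cases hl : l = i
        · subst hl; simp [hij]; ring
        · by_cases hl2 : l = j
          · subst hl2; simp [hl]; ring
          · simp [hl, hl2]
      rw [Finset.sum_congr rfl fun l _ => e1 l, Finset.sum_sub_distrib, Finset.sum_add_distrib, hr]
      simp; ring
  have h4 : HasDerivAt (fun ε : ℝ => eval (fun q : Fin s × Fin n =>
      ξ q.1 q.2 + ε * (if q.1 = j then ξ i q.2 else 0)) P) 0 0 :=
    (hasDerivAt_const (0:ℝ) (0:ℝ)).congr_of_eventuallyEq h2
  have h5 := h1.unique h4
  rw [pol_apply, map_sum]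
  simp only [map_mul, eval_X]
  rw [← h5, Fintype.sum_prod_type, Finset.sum_eq_single j]
  · simp
  · intro b _ hb
    simp [hb]
  · simp

/-- Multihomogeneity. -/
def MHom {s n : ℕ} (P : MvPolynomial (Fin s × Fin n) ℝ) (lam : Fin s → ℕ) : Prop :=
  ∀ l, IsWeightedHomogeneous (fun q : Fin s × Fin n => if q.1 = l then 1 else 0) P (lam l)

lemma MHom.euler {s n : ℕ} {P : MvPolynomial (Fin s × Fin n) ℝ} {lam : Fin s → ℕ}
    (h : MHom P lam) (l : Fin s) : JetVar.pol l l P = (lam l : ℝ) • P := by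
  have h1 := (h l).sum_weight_X_mul_pderiv
  rw [Fintype.sum_prod_type, Finset.sum_eq_single l] at h1
  · simp only [if_true, one_smul] at h1
    rw [pol_apply, h1, Nat.cast_smul_eq_nsmul]
  · intro b _ hb
    simp [hb]
  · simp

lemma MHom.support_zero {s n : ℕ} {P : MvPolynomial (Fin s × Fin n) ℝ} {lam : Fin s → ℕ}
    (h : MHom P lam) {l : Fin s} (hl : lam l = 0) (d : Fin s × Fin n →₀ ℕ) (hd : d ∈ P.support)
    (a : Fin n) : d (l, a) = 0 := by
  have h1 := h l (mem_support_iff.1 hd)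
  rw [hl, Finsupp.weight_apply, Finsupp.sum_fintype _ _ (by simp)] at h1
  have h2 := (Finset.sum_eq_zero_iff.1 h1) (l, a) (Finset.mem_univ _)
  simpa using h2

lemma MHom.pderiv_zero {s n : ℕ} {P : MvPolynomial (Fin s × Fin n) ℝ} {lam : Fin s → ℕ}
    (h : MHom P lam) {l : Fin s} (hl : lam l = 0) (a : Fin n) : pderiv (l, a) P = 0 := by
  apply pderiv_eq_zero_of_notMem_vars
  intro hv
  rw [mem_vars_iff_mem_support] at hv
  obtain ⟨d, hd, hda⟩ := hv
  exact (Finsupp.mem_support_iff.1 hda) (h.support_zero hl d hd a)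

lemma MHom.pol {s n : ℕ} {P : MvPolynomial (Fin s × Fin n) ℝ} {lam : Fin s → ℕ}
    (h : MHom P lam) {i j : Fin s} (hij : i ≠ j) (hj : 0 < lam j) :
    MHom (JetVar.pol i j P) (fun l => if l = i then lam i + 1 else if l = j then lam j - 1
      else lam l) := by
  intro l
  rw [pol_apply]
  apply IsWeightedHomogeneous.sum
  intro a _
  have hX := isWeightedHomogeneous_X (R := ℝ)
    (fun q : Fin s × Fin n => if q.1 = l then 1 else 0) (i, a)
  by_cases hli : l = i
  · subst hli
    have hP := (h l).pderiv (i := (j, a)) (n' := lam l) (by simp [hij.symm])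
    have := hX.mul hP
    simpa [add_comm] using this
  · by_cases hlj : l = j
    · subst hlj
      have hP := (h l).pderiv (i := (l, a)) (n' := lam l - 1) (by simp; omega)
      have := hX.mul hP
      simpa [hij, hij.symm] using this
    · have hP := (h l).pderiv (i := (j, a)) (n' := lam l) (by simp [Ne.symm hlj])
      have := hX.mul hP
      simpa [hli, hlj, Ne.symm hli] using this

/-- Multihomogeneous polynomials vanishing on row-dependent matrices lie in the ideal of
maximal minors. -/
theorem mem_minI {s n : ℕ} : ∀ (N : ℕ) (P : MvPolynomial (Fin (s+1) × Fin n) ℝ)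
    (lam : Fin (s+1) → ℕ), (∑ l : Fin (s+1), (l:ℕ) * lam l = N) → MHom P lam → VanRel P →
      P ∈ minI (s+1) n := by
  intro N
  induction N using Nat.strong_induction_on with
  | _ N ih =>
  intro P lam hN hP hV
  rcases Nat.eq_zero_or_pos (lam (Fin.last s)) with h0 | h0
  · have : P = 0 := by
      apply MvPolynomial.funext
      intro x
      rw [map_zero]
      set ξ : Fin (s+1) → Fin n → ℝ :=
        Fin.snoc (α := fun _ => Fin n → ℝ) (fun l a => x (l.castSucc, a))
          (-∑ l : Fin s, fun a => x (l.castSucc, a)) with hξ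
      have h1 := hV ξ (fun _ => 1) (by simp) (by
        simp only [one_smul]
        rw [Fin.sum_univ_castSucc]
        simp [hξ])
      rw [← h1, eval_eq, eval_eq]
      refine Finset.sum_congr rfl fun d hd => ?_
      congr 1
      refine Finset.prod_congr rfl fun q hq => ?_
      obtain ⟨l, a⟩ := q
      refine Fin.lastCases ?_ (fun l => ?_) l
      · rw [hP.support_zero h0 d hd]; simp
      · simp [hξ]
    rw [this]; exact zero_mem _
  · have hE : ∀ i j : Fin (s+1), i < j → pol i j P ∈ minI (s+1) n := by
      intro i j hij
      rcases Nat.eq_zero_or_pos (lam j) with hj | hj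
      · have : pol i j P = 0 := by
          rw [pol_apply]
          exact Finset.sum_eq_zero fun a _ => by rw [hP.pderiv_zero hj, mul_zero]
        rw [this]; exact zero_mem _
      · refine ih _ ?_ _ _ rfl (hP.pol hij.ne hj) (hV.pol hij.ne)
        rw [← hN]
        have e1 : ∀ l : Fin (s+1), (l:ℕ) * (if l = i then lam i + 1 else if l = j then lam j - 1
            else lam l) + (if l = j then (j:ℕ) else 0)
            = (l:ℕ) * lam l + (if l = i then (i:ℕ) else 0) := by
          intro l
          by_cases hli : l = i
          · subst hli; simp [hij.ne]; ring
          · by_cases hlj : l = j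
            · subst hlj
              obtain ⟨k, hk⟩ : ∃ k, lam l = k + 1 := ⟨lam l - 1, by omega⟩
              simp [hli, hk]; ring
            · simp [hli, hlj]
        have e2 := Finset.sum_congr rfl fun l (_ : l ∈ Finset.univ) => e1 l
        rw [Finset.sum_add_distrib, Finset.sum_add_distrib] at e2
        simp only [Finset.sum_ite_eq', Finset.mem_univ, if_true] at e2
        have : (i:ℕ) < j := hij
        omega
    obtain ⟨c, -, hc, hpos, -⟩ := capT_scalar P lam hE hP.euler h0 (id : Fin (s+1) → Fin (s+1))
      Function.injective_id
    have hpos := hpos ⟨Fin.last s, rfl⟩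
    have h1 : c • P ∈ minI (s+1) n := by
      have := sub_mem (capT_id_mem P) hc
      simpa using this
    have h2 := rsmul_mem c⁻¹ h1
    rwa [smul_smul, inv_mul_cancel₀ hpos.ne', one_smul] at h2

end JetVar


namespace JetVar
open MvPolynomial

/-- concatenation of tuples -/
def apd {n s : ℕ} (hs : s ≤ n) (w : Fin s → Fin n) (iv : Fin (n - s) → Fin n) : Fin n → Fin n :=
  fun a : Fin n => Fin.append w iv (Fin.cast (by omega) a)

/-- splitting `Fin n` -/
def spl {n s : ℕ} (hs : s ≤ n) : Fin s ⊕ Fin (n - s) ≃ Fin n :=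
  finSumFinEquiv.trans (finCongr (by omega))

lemma apd_eq {n s : ℕ} (hs : s ≤ n) (w : Fin s → Fin n) (iv : Fin (n - s) → Fin n) :
    apd hs w iv = Sum.elim w iv ∘ (spl hs).symm := by
  funext a
  obtain ⟨b, rfl⟩ := (spl hs).surjective a
  simp only [Function.comp, Equiv.symm_apply_apply]
  rcases b with b | b <;> simp [apd, spl]

lemma epsSign_comp {n : ℕ} (v : Fin n → Fin n) (π : Equiv.Perm (Fin n)) :
    epsSign (v ∘ π) = ((Equiv.Perm.sign π : ℤ) : ℝ) * epsSign v := by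
  unfold epsSign
  by_cases h : Function.Bijective v
  · have h2 : Function.Bijective (v ∘ π) := h.comp π.bijective
    rw [dif_pos h, dif_pos h2]
    have : Equiv.ofBijective (v ∘ π) h2 = Equiv.ofBijective v h * π := by
      ext x; simp
    rw [this, Equiv.Perm.sign_mul]
    push_cast
    ring
  · have h2 : ¬ Function.Bijective (v ∘ π) := fun h2 => h (by
      have := h2.comp π.symm.bijective
      simpa [Function.comp_assoc] using this)
    rw [dif_neg h, dif_neg h2, mul_zero]

lemma eps_apd {n s : ℕ} (hs : s ≤ n) (w : Fin s → Fin n) (iv : Fin (n - s) → Fin n)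
    (τ : Equiv.Perm (Fin s)) (ρ : Equiv.Perm (Fin (n - s))) :
    epsSign (apd hs (w ∘ τ) (iv ∘ ρ)) = ((Equiv.Perm.sign τ : ℤ) : ℝ) *
      ((Equiv.Perm.sign ρ : ℤ) : ℝ) * epsSign (apd hs w iv) := by
  have : apd hs (w ∘ τ) (iv ∘ ρ) = apd hs w iv ∘
      ((spl hs).permCongr (Equiv.Perm.sumCongr τ ρ)) := by
    rw [apd_eq, apd_eq]
    funext a
    obtain ⟨b, rfl⟩ := (spl hs).surjective a
    rcases b with b | b <;> simp [Equiv.permCongr_apply]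
  rw [this, epsSign_comp, Equiv.Perm.sign_permCongr, Equiv.Perm.sign_sumCongr]
  push_cast
  ring

lemma eps_apd_left {n s : ℕ} (hs : s ≤ n) (w : Fin s → Fin n) (iv : Fin (n - s) → Fin n)
    (τ : Equiv.Perm (Fin s)) :
    epsSign (apd hs (w ∘ τ) iv) = ((Equiv.Perm.sign τ : ℤ) : ℝ) * epsSign (apd hs w iv) := by
  have := eps_apd hs w iv τ 1
  simpa using this

lemma hyperJ_eq {n m r s : ℕ} (hs : s ≤ n) (I : Fin s → (Fin n → ℕ)) (σs : Fin s → Fin m)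
    (iv : Fin (n - s) → Fin n) (p : Jet n m r) :
    hyperJ s hs I σs iv p = ∑ w : Fin s → Fin n, epsSign (apd hs w iv) *
      ∏ l : Fin s, yc (σs l) (addE (I l) (w l)) p := rfl

lemma hyperJ_perm {n m r s : ℕ} (hs : s ≤ n) (I : Fin s → (Fin n → ℕ)) (σs : Fin s → Fin m)
    (iv : Fin (n - s) → Fin n) (p : Jet n m r) (τ : Equiv.Perm (Fin s))
    (ρ : Equiv.Perm (Fin (n - s))) :
    hyperJ s hs (I ∘ τ) (σs ∘ τ) (iv ∘ ρ) p = ((Equiv.Perm.sign τ : ℤ) : ℝ) *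
      ((Equiv.Perm.sign ρ : ℤ) : ℝ) * hyperJ s hs I σs iv p := by
  rw [hyperJ_eq, hyperJ_eq, Finset.mul_sum,
    ← Equiv.sum_comp (Equiv.arrowCongr τ.symm (Equiv.refl (Fin n)))]
  refine Finset.sum_congr rfl fun w _ => ?_
  have h1 : (Equiv.arrowCongr τ.symm (Equiv.refl (Fin n))) w = w ∘ τ := by
    ext; simp [Equiv.arrowCongr]
  rw [h1, eps_apd, mul_assoc, mul_assoc, mul_assoc]
  congr 3
  exact Equiv.prod_comp τ fun l => yc (σs l) (addE (I l) (w l)) p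

lemma exists_compl {n s : ℕ} (hs : s ≤ n) (a : Fin s → Fin n) (ha : Function.Injective a) :
    ∃ iv : Fin (n - s) → Fin n, Function.Bijective (apd hs a iv) := by
  classical
  have hc : (Finset.univ \ Finset.univ.image a).card = n - s := by
    rw [Finset.card_sdiff_of_subset (Finset.subset_univ _), Finset.card_image_of_injective _ ha]
    simp
  refine ⟨fun k => ((Finset.equivFinOfCardEq hc).symm k).1, ?_⟩
  rw [apd_eq]
  refine (Finite.injective_iff_bijective.1 ?_)
  refine Function.Injective.comp ?_ (spl hs).symm.injective
  apply Function.Injective.sumElim ha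
  · intro k k' h
    exact (Finset.equivFinOfCardEq hc).symm.injective (Subtype.ext h)
  · intro l k h
    have := ((Finset.equivFinOfCardEq hc).symm k).2
    rw [← h] at this
    simp at this

lemma minr_zero {n s : ℕ} (a : Fin s → Fin n) (ha : ¬ Function.Injective a) : minr a = 0 := by
  rw [minr_eq_det]
  simp only [Function.Injective, not_forall] at ha
  obtain ⟨i, j, hij, hne⟩ := ha
  exact Matrix.det_zero_of_column_eq hne (by intro k; simp [hij])

lemma minr_eps {n s : ℕ} (hs : s ≤ n) (a : Fin s → Fin n) (iv : Fin (n - s) → Fin n)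
    (h : Function.Bijective (apd hs a iv)) :
    minr a = ∑ w : Fin s → Fin n, (epsSign (apd hs a iv) * epsSign (apd hs w iv)) •
      ∏ l, (X (l, w l) : MvPolynomial (Fin s × Fin n) ℝ) := by
  classical
  have ha : Function.Injective a := by
    intro i j hij
    rw [apd_eq] at h
    have h2 := (Equiv.bijective (spl hs)).injective
    have := h.1 (a₁ := spl hs (Sum.inl i)) (a₂ := spl hs (Sum.inl j)) (by simpa using hij)
    simpa using this
  have hsq : epsSign (apd hs a iv) * epsSign (apd hs a iv) = 1 := by
    unfold epsSign
    rw [dif_pos h]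
    rcases Int.units_eq_one_or (Equiv.Perm.sign (Equiv.ofBijective _ h)) with h1 | h1 <;>
      simp [h1]
  rw [minr, ← Equiv.sum_comp (Equiv.inv (Equiv.Perm (Fin s)))]
  refine Finset.sum_of_injOn (fun π : Equiv.Perm (Fin s) => a ∘ π) ?_ ?_ ?_ ?_
  · intro π _ π' _ hh
    ext l
    have := ha (congrFun hh l)
    simp [this]
  · intro _ _; simp
  · intro w _ hw
    by_cases hb : Function.Bijective (apd hs w iv)
    · exfalso
      rw [apd_eq] at hb h
      have hwi : Function.Injective w := by
        intro i j hij
        have := hb.1 (a₁ := spl hs (Sum.inl i)) (a₂ := spl hs (Sum.inl j)) (by simpa using hij)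
        simpa using this
      have hr : ∀ l, ∃ k, a k = w l := by
        intro l
        obtain ⟨b, hb1⟩ := h.2 (w l)
        obtain ⟨c, rfl⟩ := (spl hs).surjective b
        rcases c with c | c
        · exact ⟨c, by simpa using hb1⟩
        · exfalso
          have := hb.1 (a₁ := spl hs (Sum.inl l)) (a₂ := spl hs (Sum.inr c))
            (by simpa using hb1.symm)
          simp at this
      choose f hf using hr
      have hfi : Function.Injective f := by
        intro i j hij
        apply hwi
        rw [← hf, ← hf, hij]
      apply hw
      refine ⟨Equiv.ofBijective f (Finite.injective_iff_bijective.1 hfi), by simp, ?_⟩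
      funext l
      simp [hf]
    · have : epsSign (apd hs w iv) = 0 := by rw [epsSign, dif_neg hb]
      rw [this]; simp
  · intro π _
    simp only [Equiv.inv_apply]
    rw [eps_apd_left, mul_left_comm, hsq, mul_one, Equiv.Perm.sign_inv]
    congr 1
    rw [← Equiv.prod_comp π]
    simp

/-- exponent attached to a tuple of multi-indices -/
noncomputable def expo {n s : ℕ} (J : Fin s → Fin n → ℕ) : Fin s × Fin n →₀ ℕ :=
  Finsupp.equivFunOnFinite.symm fun q => J q.1 q.2

lemma expo_apply {n s : ℕ} (J : Fin s → Fin n → ℕ) (q : Fin s × Fin n) :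
    expo J q = J q.1 q.2 := by
  simp [expo]

lemma expo_inj {n s : ℕ} {J J' : Fin s → Fin n → ℕ} (h : expo J = expo J') : J = J' := by
  funext l i
  have := DFunLike.congr_fun h (l, i)
  simpa [expo_apply] using this

/-- The polynomial with given coefficients. -/
noncomputable def polyB {n s r : ℕ} (B : (Fin s → MD n r) → ℝ) :
    MvPolynomial (Fin s × Fin n) ℝ :=
  ∑ J : Fin s → MD n r, monomial (expo fun l => (J l).1) (B J)

lemma coeff_polyB {n s r : ℕ} (B : (Fin s → MD n r) → ℝ) (J : Fin s → MD n r) :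
    coeff (expo fun l => (J l).1) (polyB B) = B J := by
  classical
  rw [polyB, coeff_sum, Finset.sum_eq_single J]
  · simp
  · intro J' _ hne
    rw [coeff_monomial, if_neg]
    intro h
    apply hne
    funext l
    exact Subtype.ext (congrFun (expo_inj h) l)
  · simp

lemma MHom_polyB {n s r : ℕ} (B : (Fin s → MD n r) → ℝ)
    (hB : ∀ J l, (∑ i, (J l).1 i) ≠ r → B J = 0) : MHom (polyB B) (fun _ => r) := by
  intro l
  apply IsWeightedHomogeneous.sum
  intro J _
  by_cases h : (∑ i, (J l).1 i) = r
  · apply isWeightedHomogeneous_monomial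
    rw [Finsupp.weight_apply, Finsupp.sum_fintype _ _ (by simp), Fintype.sum_prod_type,
      Finset.sum_eq_single l]
    · simpa [expo_apply] using h
    · intro b _ hb; simp [hb]
    · simp
  · rw [hB J l h, monomial_zero]
    exact isWeightedHomogeneous_zero _ _ _

lemma eval_polyB {n s r : ℕ} (B : (Fin s → MD n r) → ℝ) (ξ : Fin s → Fin n → ℝ) :
    eval (fun q => ξ q.1 q.2) (polyB B) = ∑ J, B J * ∏ l, ∏ i, ξ l i ^ (J l).1 i := by
  rw [polyB, map_sum]
  refine Finset.sum_congr rfl fun J _ => ?_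
  rw [eval_monomial, Finsupp.prod_fintype _ _ (by simp), Fintype.prod_prod_type]
  simp [expo_apply]

/-- The linear map from hyper-Jacobian coefficients to polynomial coefficients. -/
noncomputable def PhiM (n s r : ℕ) (hs : s ≤ n) :
    ((Fin s → MD n (r-1)) → (Fin (n-s) → Fin n) → ℝ) →ₗ[ℝ] ((Fin s → MD n r) → ℝ) where
  toFun q J := ∑ I : Fin s → MD n (r-1), ∑ iv : Fin (n-s) → Fin n,
    q I iv * ∑ w : Fin s → Fin n, epsSign (apd hs w iv) *
      (if (∀ l, (∑ i, (I l).1 i) = r - 1) ∧ ∀ l, (J l).1 = addE (I l).1 (w l) then 1 else 0)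
  map_add' q q' := by
    funext J
    simp only [Pi.add_apply, add_mul, Finset.sum_add_distrib]
  map_smul' c q := by
    funext J
    simp only [Pi.smul_apply, smul_eq_mul, RingHom.id_apply, Finset.mul_sum, mul_assoc]

lemma addE_sum {n : ℕ} (I : Fin n → ℕ) (i : Fin n) : ∑ j, addE I i j = (∑ j, I j) + 1 := by
  simp [addE, Finset.sum_add_distrib]

lemma coeff_shift {n s r : ℕ} (hr : 1 ≤ r) (g : MvPolynomial (Fin s × Fin n) ℝ)
    (J : Fin s → MD n r) (hJ : ∀ l, (∑ i, (J l).1 i) = r) (w : Fin s → Fin n) :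
    coeff (expo fun l => (J l).1) (g * ∏ l, X (l, w l)) =
      ∑ I : Fin s → MD n (r-1), coeff (expo fun l => (I l).1) g *
       (if (∀ l, (∑ i, (I l).1 i) = r - 1) ∧ ∀ l, (J l).1 = addE (I l).1 (w l) then 1 else 0) := by
  classical
  set e : Fin s × Fin n →₀ ℕ := expo fun l => fun i => if i = w l then 1 else 0 with he
  have hX : (∏ l, X (l, w l) : MvPolynomial (Fin s × Fin n) ℝ) = monomial e 1 := by
    simp only [X]
    rw [← monomial_sum_one]
    congr 1
    refine congrArg (fun e => (monomial e : ℝ →ₗ[ℝ] MvPolynomial (Fin s × Fin n) ℝ)) ?_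
    refine Finsupp.ext fun q => ?_
    simp only [Finsupp.coe_finsetSum, Finset.sum_apply, he, expo_apply, Finsupp.single_apply]
    rw [Finset.sum_eq_single q.1]
    · simp only [Prod.ext_iff, true_and]
      congr 1
      exact propext eq_comm
    · intro b _ hb
      rw [if_neg]
      intro h
      exact hb (by rw [← h])
    · simp
  have hadd : ∀ I : Fin s → Fin n → ℕ, expo (fun l => addE (I l) (w l)) = expo I + e := by
    intro I
    ext q
    simp [he, expo_apply, addE]
  rw [hX, coeff_mul_monomial', mul_one]
  by_cases hle : e ≤ expo fun l => (J l).1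
  · rw [if_pos hle]
    have hge : ∀ l, 1 ≤ (J l).1 (w l) := by
      intro l
      have := hle (l, w l)
      simpa [he, expo_apply] using this
    have hsub : ∀ l, addE (subE (J l).1 (w l)) (w l) = (J l).1 := by
      intro l
      funext i
      by_cases hi : i = w l
      · subst hi; have := hge l; simp [addE, subE]; omega
      · simp [addE, subE, hi]
    have hsum : ∀ l, ∑ i, subE (J l).1 (w l) i = r - 1 := by
      intro l
      have h1 := addE_sum (subE (J l).1 (w l)) (w l)
      rw [hsub, hJ] at h1
      omega
    rw [Finset.sum_eq_single (fun l => (⟨subE (J l).1 (w l), (hsum l).le⟩ : MD n (r-1)))]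
    · rw [if_pos ⟨hsum, fun l => (hsub l).symm⟩, mul_one]
      congr 1
      have := hadd (fun l => subE (J l).1 (w l))
      simp only [hsub] at this
      rw [this]
      simp
    · intro I _ hI
      rw [if_neg, mul_zero]
      rintro ⟨-, h2⟩
      apply hI
      funext l
      apply Subtype.ext
      funext i
      have h3 := congrFun ((h2 l).symm.trans (hsub l).symm) i
      simp only [addE] at h3
      simp only
      omega
    · simp
  · rw [if_neg hle]
    symm
    apply Finset.sum_eq_zero
    intro I _
    rw [if_neg, mul_zero]
    rintro ⟨-, h2⟩
    apply hle
    have : (fun l => (J l).1) = fun l => addE (I l).1 (w l) := funext h2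
    rw [this, hadd]
    exact le_add_self

lemma mem_range_Phi {n s r : ℕ} (hr : 1 ≤ r) (hs : s ≤ n) (B : (Fin s → MD n r) → ℝ)
    (hB : ∀ J l, (∑ i, (J l).1 i) ≠ r → B J = 0) (hP : polyB B ∈ minI s n) :
    B ∈ LinearMap.range (PhiM n s r hs) := by
  classical
  rw [minI, Ideal.mem_span_range_iff_exists_fun] at hP
  obtain ⟨g, hg⟩ := hP
  have hiv : ∀ a : Fin s → Fin n, ∃ iv : Fin (n - s) → Fin n, Function.Injective a →
      Function.Bijective (apd hs a iv) := by
    intro a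
    by_cases ha : Function.Injective a
    · obtain ⟨iv, h⟩ := exists_compl hs a ha
      exact ⟨iv, fun _ => h⟩
    · by_cases hn : n = 0
      · subst hn; exact ⟨fun k => absurd k.2 (by omega), fun h => absurd h ha⟩
      · exact ⟨fun _ => ⟨0, by omega⟩, fun h => absurd h ha⟩
  choose iva hiva using hiv
  refine ⟨fun I iv => ∑ a : Fin s → Fin n, if Function.Injective a ∧ iv = iva a then
    epsSign (apd hs a iv) * coeff (expo fun l => (I l).1) (g a) else 0, ?_⟩
  funext J
  show ∑ I : Fin s → MD n (r-1), ∑ iv : Fin (n-s) → Fin n, _ = _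
  by_cases hJ : ∀ l, (∑ i, (J l).1 i) = r
  · rw [← coeff_polyB B J, ← hg, coeff_sum]
    have h1 : ∀ a, coeff (expo fun l => (J l).1) (g a * minr a) =
        ∑ I : Fin s → MD n (r-1), ∑ iv : Fin (n-s) → Fin n, ∑ w : Fin s → Fin n,
        (if Function.Injective a ∧ iv = iva a then
          epsSign (apd hs a iv) * coeff (expo fun l => (I l).1) (g a) else 0) *
          (epsSign (apd hs w iv) *
      (if (∀ l, (∑ i, (I l).1 i) = r - 1) ∧ ∀ l, (J l).1 = addE (I l).1 (w l) then 1 else 0)) := by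
      intro a
      by_cases ha : Function.Injective a
      · rw [minr_eps hs a (iva a) (hiva a ha), Finset.mul_sum, coeff_sum]
        simp only [mul_smul_comm, coeff_smul, coeff_shift hr (g a) J hJ, smul_eq_mul, Finset.mul_sum]
        rw [Finset.sum_comm]
        refine Finset.sum_congr rfl fun I _ => ?_
        symm
        rw [Finset.sum_eq_single (iva a)]
        · refine Finset.sum_congr rfl fun w _ => ?_
          rw [if_pos ⟨ha, rfl⟩]
          ring
        · intro iv _ hne
          simp [hne]
        · simp
      · rw [minr_zero a ha]
        simp [ha]
    simp only [h1, Finset.sum_mul, Finset.mul_sum]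
    conv_rhs => rw [Finset.sum_comm]
    refine Finset.sum_congr rfl fun I _ => ?_
    conv_rhs => rw [Finset.sum_comm]
    refine Finset.sum_congr rfl fun iv _ => ?_
    exact Finset.sum_comm
  · push Not at hJ
    obtain ⟨l, hl⟩ := hJ
    rw [hB J l hl]
    refine Finset.sum_eq_zero fun I _ => Finset.sum_eq_zero fun iv _ => ?_
    rw [Finset.sum_eq_zero, mul_zero]
    intro w _
    rw [if_neg, mul_zero]
    rintro ⟨h1, h2⟩
    apply hl
    rw [h2 l, addE_sum, h1 l]
    omega

lemma polyB_big {n r : ℕ} (B : (Fin (n+1) → MD n r) → ℝ) (hP : polyB B ∈ minI (n+1) n) :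
    B = 0 := by
  have h0 : minI (n+1) n = ⊥ := by
    rw [minI, Ideal.span_eq_bot]
    rintro _ ⟨a, rfl⟩
    apply minr_zero
    intro ha
    have := Fintype.card_le_of_injective a ha
    simp at this
  rw [h0, Ideal.mem_bot] at hP
  funext J
  rw [← coeff_polyB B J, hP]
  simp

/-- section -/
lemma exists_sec (n s r : ℕ) (hs : s ≤ n) : ∃ S : ((Fin s → MD n r) → ℝ) →ₗ[ℝ]
    ((Fin s → MD n (r-1)) → (Fin (n-s) → Fin n) → ℝ),
    ∀ B ∈ LinearMap.range (PhiM n s r hs), PhiM n s r hs (S B) = B := by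
  obtain ⟨S0, hS0⟩ := LinearMap.exists_rightInverse_of_surjective (PhiM n s r hs).rangeRestrict
    (LinearMap.range_rangeRestrict _)
  obtain ⟨S, hS⟩ := LinearMap.exists_extend S0
  refine ⟨S, fun B hB => ?_⟩
  have h1 : S B = S0 ⟨B, hB⟩ := LinearMap.congr_fun hS ⟨B, hB⟩
  rw [h1]
  have h2 := LinearMap.congr_fun hS0 ⟨B, hB⟩
  exact congrArg Subtype.val h2

lemma Phi_hyperJ {n m s r : ℕ} (hr : 1 ≤ r) (hs : s ≤ n)
    (q : (Fin s → MD n (r-1)) → (Fin (n-s) → Fin n) → ℝ) (ν : Fin s → Fin m) (p : Jet n m r) :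
    ∑ J : Fin s → MD n r, PhiM n s r hs q J * ∏ l, yc (ν l) (J l).1 p =
    ∑ I : Fin s → MD n (r-1), ∑ iv : Fin (n-s) → Fin n,
      (if ∀ l, (∑ i, (I l).1 i) = r - 1 then (1:ℝ) else 0) * q I iv *
        hyperJ s hs (fun l => (I l).1) ν iv p := by
  classical
  simp only [PhiM, LinearMap.coe_mk, AddHom.coe_mk, Finset.sum_mul, hyperJ_eq, Finset.mul_sum]
  rw [Finset.sum_comm]
  refine Finset.sum_congr rfl fun I _ => ?_
  rw [Finset.sum_comm]
  refine Finset.sum_congr rfl fun iv _ => ?_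
  rw [Finset.sum_comm]
  refine Finset.sum_congr rfl fun w _ => ?_
  by_cases hI : ∀ l, (∑ i, (I l).1 i) = r - 1
  · have hle : ∀ l, ∑ i, addE (I l).1 (w l) i ≤ r := by
      intro l; rw [addE_sum, hI l]; omega
    rw [Finset.sum_eq_single (fun l => (⟨addE (I l).1 (w l), hle l⟩ : MD n r))]
    · simp [hI]; ring
    · intro J _ hJ
      rw [if_neg]
      · simp
      rintro ⟨-, h2⟩
      apply hJ
      funext l
      exact Subtype.ext (h2 l)
    · simp
  · simp [hI]

end JetVar


namespace JetVar

lemma sum_comp_perm {s : ℕ} {α M : Type*} [Fintype α] [AddCommMonoid M]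
    (τ : Equiv.Perm (Fin s)) (F : (Fin s → α) → M) : ∑ I, F (I ∘ τ) = ∑ I, F I := by
  have := Equiv.sum_comp (Equiv.arrowCongr τ.symm (Equiv.refl α)) F
  rw [← this]
  refine Finset.sum_congr rfl fun I _ => ?_
  congr 1

lemma sgn_sq {α : Type*} [Fintype α] [DecidableEq α] (τ : Equiv.Perm α) :
    ((Equiv.Perm.sign τ : ℤ) : ℝ) * ((Equiv.Perm.sign τ : ℤ) : ℝ) = 1 := by
  rcases Int.units_eq_one_or (Equiv.Perm.sign τ) with h1 | h1 <;> simp [h1]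

/-- antisymmetrisation -/
noncomputable def antis {n m r : ℕ} (C : CoefFam n m r) : CoefFam n m r :=
  fun s I ν iv b => ((s.factorial : ℕ) : ℝ)⁻¹ * ∑ τ : Equiv.Perm (Fin s),
    ∑ ρ : Equiv.Perm (Fin (n-s)), ((Equiv.Perm.sign τ : ℤ) : ℝ) * ((Equiv.Perm.sign ρ : ℤ) : ℝ) *
      C s (I ∘ τ) (ν ∘ τ) (iv ∘ ρ) b

lemma antis_alt {n m r : ℕ} (C : CoefFam n m r) : IsAltSymC (antis C) := by
  intro s τ ρ I ν iv b
  unfold antis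
  rw [mul_left_comm]
  congr 1
  rw [Finset.mul_sum]
  conv_rhs => rw [← Equiv.sum_comp (Equiv.mulLeft τ)]
  refine Finset.sum_congr rfl fun τ' _ => ?_
  rw [Finset.mul_sum]
  refine Eq.trans ?_ (Equiv.sum_comp (Equiv.mulLeft ρ) _)
  refine Finset.sum_congr rfl fun ρ' _ => ?_
  simp only [Equiv.coe_mulLeft, Equiv.Perm.sign_mul, Equiv.Perm.coe_mul, Function.comp_assoc]
  push_cast
  have h1 := sgn_sq τ
  have h2 := sgn_sq ρ
  generalize C s _ _ _ b = c
  linear_combination (-((Equiv.Perm.sign τ' : ℤ) : ℝ) * ((Equiv.Perm.sign ρ' : ℤ) : ℝ) * c) * h1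
    - (((Equiv.Perm.sign τ' : ℤ) : ℝ) * ((Equiv.Perm.sign ρ' : ℤ) : ℝ) * c) *
      ((Equiv.Perm.sign τ : ℤ) : ℝ) * ((Equiv.Perm.sign τ : ℤ) : ℝ) * h2

lemma antis_sum {n m r : ℕ} (C : CoefFam n m r) (s : ℕ) (hs : s ≤ n) (p : Jet n m r)
    (b : Jet n m (r-1)) :
    ∑ I : Fin s → MD n (r-1), ∑ σs : Fin s → Fin m,
        ∑ iv : Fin (n - s) → Fin n,
          (if ∀ l, (∑ i, (I l).1 i) = r - 1 then (1:ℝ) else 0) *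
            antis C s (fun l => (I l).1) σs iv b *
            hyperJ s hs (fun l => (I l).1) σs iv p =
    ((n - s).factorial : ℝ) * ∑ I : Fin s → MD n (r-1), ∑ σs : Fin s → Fin m,
        ∑ iv : Fin (n - s) → Fin n,
          (if ∀ l, (∑ i, (I l).1 i) = r - 1 then (1:ℝ) else 0) *
            C s (fun l => (I l).1) σs iv b *
            hyperJ s hs (fun l => (I l).1) σs iv p := by
  set F : (Fin s → MD n (r-1)) → (Fin s → Fin m) → (Fin (n-s) → Fin n) → ℝ := fun I σs iv =>
    (if ∀ l, (∑ i, (I l).1 i) = r - 1 then (1:ℝ) else 0) *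
            C s (fun l => (I l).1) σs iv b *
            hyperJ s hs (fun l => (I l).1) σs iv p with hF
  have h1 : ∀ I σs iv, (if ∀ l, (∑ i, ((I : Fin s → MD n (r-1)) l).1 i) = r - 1 then (1:ℝ) else 0) *
            antis C s (fun l => (I l).1) σs iv b *
            hyperJ s hs (fun l => (I l).1) σs iv p = ((s.factorial : ℕ) : ℝ)⁻¹ *
            ∑ τ : Equiv.Perm (Fin s),
    ∑ ρ : Equiv.Perm (Fin (n-s)), F (I ∘ τ) (σs ∘ τ) (iv ∘ ρ) := by
    intro I σs iv
    rw [antis, mul_left_comm, mul_assoc]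
    congr 1
    rw [Finset.mul_sum, Finset.sum_mul]
    refine Finset.sum_congr rfl fun τ _ => ?_
    rw [Finset.mul_sum, Finset.sum_mul]
    refine Finset.sum_congr rfl fun ρ _ => ?_
    have h2 := hyperJ_perm hs (fun l => (I l).1) σs iv p τ ρ
    have h3 : (fun l => (I l).1) ∘ τ = fun l => ((I ∘ τ) l).1 := rfl
    have h4 : (∀ l, (∑ i, ((I ∘ τ) l).1 i) = r - 1) ↔ ∀ l, (∑ i, (I l).1 i) = r - 1 :=
      ⟨fun h l => by simpa using h (τ.symm l), fun h l => h (τ l)⟩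
    simp only [hF, h4]
    rw [h3] at h2
    rw [h2, h3]
    ring
  simp only [h1, ← Finset.mul_sum]
  have h5 : ∑ I : Fin s → MD n (r-1), ∑ σs : Fin s → Fin m, ∑ iv : Fin (n - s) → Fin n,
      ∑ τ : Equiv.Perm (Fin s), ∑ ρ : Equiv.Perm (Fin (n-s)), F (I ∘ τ) (σs ∘ τ) (iv ∘ ρ) =
      ∑ τ : Equiv.Perm (Fin s), ∑ ρ : Equiv.Perm (Fin (n-s)),
      ∑ I : Fin s → MD n (r-1), ∑ σs : Fin s → Fin m, ∑ iv : Fin (n - s) → Fin n,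
       F (I ∘ τ) (σs ∘ τ) (iv ∘ ρ) := by
    simp only [← Fintype.sum_prod_type']
    exact Fintype.sum_equiv ⟨fun x => (x.2.2.2.1, x.2.2.2.2, x.1, x.2.1, x.2.2.1),
      fun x => (x.2.2.1, x.2.2.2.1, x.2.2.2.2, x.1, x.2.1), fun _ => rfl, fun _ => rfl⟩ _ _
      (fun _ => rfl)
  rw [h5]
  have h6 : ∀ (τ : Equiv.Perm (Fin s)) (ρ : Equiv.Perm (Fin (n-s))),
      ∑ I : Fin s → MD n (r-1), ∑ σs : Fin s → Fin m, ∑ iv : Fin (n - s) → Fin n,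
       F (I ∘ τ) (σs ∘ τ) (iv ∘ ρ) = ∑ I, ∑ σs, ∑ iv, F I σs iv := by
    intro τ ρ
    rw [← sum_comp_perm τ (fun I => ∑ σs, ∑ iv, F I σs iv)]
    refine Finset.sum_congr rfl fun I _ => ?_
    rw [← sum_comp_perm τ (fun σs => ∑ iv, F (I ∘ τ) σs iv)]
    refine Finset.sum_congr rfl fun σs _ => ?_
    exact sum_comp_perm ρ (fun iv => F (I ∘ τ) (σs ∘ τ) iv)
  simp only [h6, Finset.sum_const, Finset.card_univ, Fintype.card_perm, Fintype.card_fin,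
    nsmul_eq_mul]
  have : (s.factorial : ℝ) ≠ 0 := by positivity
  field_simp
  rfl

/-- Assembly of coefficient families. -/
theorem assemble {n m r : ℕ} (hr : 1 ≤ r) (W : Set (((Fin n) → ℝ) × ((Fin m) → ℝ)))
    (T : Jet n m r → ℝ)
    (B : (s : ℕ) → (Fin s → Fin m) → Jet n m (r-1) → (Fin s → MD n r) → ℝ)
    (hBs : ∀ s ν J, ContDiff ℝ (⊤:ℕ∞) (fun b => B s ν b J))
    (hB0 : ∀ s ν b J l, (∑ i, ((J : Fin s → MD n r) l).1 i) ≠ r → B s ν b J = 0)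
    (hBm : ∀ s, s ≤ n → ∀ ν, ∀ b ∈ Dset (n := n) (m := m) (r-1) W,
      polyB (B s ν b) ∈ minI s n)
    (hT : ∀ p ∈ Dset (n := n) (m := m) r W, T p = ∑ s : Fin (n+1),
      (((s:ℕ).factorial : ℕ) : ℝ)⁻¹ * ∑ ν : Fin (s:ℕ) → Fin m, ∑ J : Fin (s:ℕ) → MD n r,
        B (s:ℕ) ν (projJet (Nat.sub_le r 1) p) J * ∏ l, yc (ν l) (J l).1 p) :
    ∃ C : CoefFam n m r, IsAltSymC C ∧ (∀ s I σs iv, ContDiff ℝ (⊤:ℕ∞) (C s I σs iv)) ∧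
      ∀ p ∈ Dset (n := n) (m := m) r W, T p = LagC C p := by
  classical
  have hsec : ∀ s : ℕ, ∃ S : ((Fin s → MD n r) → ℝ) →ₗ[ℝ]
    ((Fin s → MD n (r-1)) → (Fin (n-s) → Fin n) → ℝ), ∀ hs : s ≤ n,
    ∀ B ∈ LinearMap.range (PhiM n s r hs), PhiM n s r hs (S B) = B := by
    intro s
    by_cases hs : s ≤ n
    · obtain ⟨S, hS⟩ := exists_sec n s r hs
      exact ⟨S, fun _ => hS⟩
    · exact ⟨0, fun h => absurd h hs⟩
  choose S hS using hsec
  let C0 : CoefFam n m r := fun s I ν iv b =>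
    if h : ∀ l, (∑ i, I l i) ≤ r - 1 then S s (B s ν b) (fun l => ⟨I l, h l⟩) iv else 0
  have hC0 : ∀ s I ν iv, ContDiff ℝ (⊤:ℕ∞) (C0 s I ν iv) := by
    intro s I ν iv
    by_cases h : ∀ l, (∑ i, I l i) ≤ r - 1
    · have h1 : C0 s I ν iv = fun b => S s (B s ν b) (fun l => ⟨I l, h l⟩) iv := by
        funext b; simp only [C0, dif_pos h]
      rw [h1]
      have h2 : ContDiff ℝ (⊤:ℕ∞) (fun b => B s ν b) := contDiff_pi.2 fun J => hBs s ν J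
      have h3 : ContDiff ℝ (⊤:ℕ∞) (fun b => S s (B s ν b)) :=
        ((LinearMap.toContinuousLinearMap (S s)).contDiff).comp h2
      have h4 := contDiff_pi.1 h3 (fun l => ⟨I l, h l⟩)
      exact contDiff_pi.1 h4 iv
    · have h1 : C0 s I ν iv = fun b => 0 := by
        funext b; simp only [C0, dif_neg h]
      rw [h1]; exact contDiff_const
  refine ⟨antis C0, antis_alt C0, ?_, ?_⟩
  · intro s I ν iv
    unfold antis
    refine contDiff_const.mul (ContDiff.sum fun τ _ => ContDiff.sum fun ρ _ => ?_)
    exact contDiff_const.mul (hC0 _ _ _ _)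
  · intro p hp
    rw [hT p hp, LagC]
    refine Finset.sum_congr rfl fun s _ => ?_
    have hs : (s:ℕ) ≤ n := by have := s.isLt; omega
    rw [antis_sum C0 s hs]
    push_cast
    have hf : ((n - (s:ℕ)).factorial : ℝ) ≠ 0 := by positivity
    rw [mul_inv, mul_assoc, inv_mul_cancel_left₀ hf]
    congr 1
    conv_rhs => rw [Finset.sum_comm]
    refine Finset.sum_congr rfl fun ν _ => ?_
    have hb : projJet (Nat.sub_le r 1) p ∈ Dset (n := n) (m := m) (r-1) W := by
      simpa [Dset, yc, projJet] using hp
    have h1 := Phi_hyperJ hr hs (S s (B s ν (projJet (Nat.sub_le r 1) p))) ν p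
    rw [hS s hs _ (mem_range_Phi hr hs _ (hB0 s ν _) (hBm s hs ν _ hb))] at h1
    rw [h1]
    refine Finset.sum_congr rfl fun I _ => Finset.sum_congr rfl fun iv _ => ?_
    have h2 : C0 s (fun l => (I l).1) ν iv (projJet (Nat.sub_le r 1) p) =
        S s (B s ν (projJet (Nat.sub_le r 1) p)) I iv := by
      simp only [C0]
      rw [dif_pos fun l => (I l).2]
    rw [h2]

end JetVar


namespace JetVar

/-- smoothness -/
abbrev Sm {E F : Type*} [NormedAddCommGroup E] [NormedSpace ℝ E] [NormedAddCommGroup F]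
    [NormedSpace ℝ F] (f : E → F) : Prop := ContDiff ℝ (⊤:ℕ∞) f

lemma Sm.dd {E F : Type*} [NormedAddCommGroup E] [NormedSpace ℝ E] [NormedAddCommGroup F]
    [NormedSpace ℝ F] {f : E → F} (hf : Sm f) (v : E) : Sm (fun x => fderiv ℝ f x v) :=
  (hf.fderiv_right (m := (⊤:ℕ∞)) (by simp)).clm_apply contDiff_const

lemma Sm.differentiable' {E F : Type*} [NormedAddCommGroup E] [NormedSpace ℝ E]
    [NormedAddCommGroup F] [NormedSpace ℝ F] {f : E → F} (hf : Sm f) : Differentiable ℝ f :=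
  hf.differentiable (by simp)

lemma Sm.symm2 {E F : Type*} [NormedAddCommGroup E] [NormedSpace ℝ E]
    [NormedAddCommGroup F] [NormedSpace ℝ F] {f : E → F} (hf : Sm f) (v w x : E) :
    fderiv ℝ (fun y => fderiv ℝ f y v) x w = fderiv ℝ (fun y => fderiv ℝ f y w) x v := by
  have h1 : DifferentiableAt ℝ (fderiv ℝ f) x :=
    ((hf.fderiv_right (m := (⊤:ℕ∞)) (by simp)).differentiable (by simp)) x
  have hs : IsSymmSndFDerivAt ℝ f x :=
    hf.contDiffAt.isSymmSndFDerivAt (by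
      simp only [minSmoothness_of_isRCLikeNormedField]; exact WithTop.coe_le_coe.2 (le_top : (2:ℕ∞) ≤ ⊤))
  have h2 : ∀ v w, fderiv ℝ (fun y => fderiv ℝ f y v) x w = fderiv ℝ (fderiv ℝ f) x w v := by
    intro v w
    rw [fderiv_clm_apply h1 (differentiableAt_const v)]
    simp
  rw [h2, h2]
  exact hs w v

/-- coordinate derivative on the base -/
noncomputable def pd {n : ℕ} (i : Fin n) (g : (Fin n → ℝ) → ℝ) (x : Fin n → ℝ) : ℝ :=
  fderiv ℝ g x (Pi.single i 1)

/-- iterated coordinate derivatives -/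
noncomputable def pdL {n : ℕ} : List (Fin n) → ((Fin n → ℝ) → ℝ) → (Fin n → ℝ) → ℝ
  | [], g => g
  | i :: l, g => pd i (pdL l g)

lemma Sm.pd {n : ℕ} {g : (Fin n → ℝ) → ℝ} (hg : Sm g) (i : Fin n) : Sm (pd i g) := hg.dd _

lemma Sm.pdL {n : ℕ} {g : (Fin n → ℝ) → ℝ} (hg : Sm g) (l : List (Fin n)) : Sm (pdL l g) := by
  induction l with
  | nil => exact hg
  | cons i l ih => exact ih.pd i

lemma pdL_perm {n : ℕ} {g : (Fin n → ℝ) → ℝ} (hg : Sm g) {l l' : List (Fin n)}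
    (h : l.Perm l') : pdL l g = pdL l' g := by
  induction h with
  | nil => rfl
  | cons x _ ih => simp only [pdL, ih]
  | swap x y l => funext z; exact (hg.pdL l).symm2 _ _ _
  | trans _ _ ih1 ih2 => exact ih1.trans ih2

lemma count_mlist {n : ℕ} (J : Fin n → ℕ) (a : Fin n) : (mlist J).count a = J a := by
  rw [mlist, List.count_flatMap]
  simp only [Function.comp_def, List.count_replicate]
  rw [← Fin.sum_univ_def]
  simp

lemma mlist_addE {n : ℕ} (J : Fin n → ℕ) (i : Fin n) :
    (mlist (addE J i)).Perm (i :: mlist J) := by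
  rw [List.perm_iff_count]
  intro a
  rw [count_mlist, List.count_cons, count_mlist, addE]
  by_cases h : a = i
  · simp [h]
  · simp [h, Ne.symm h]

lemma pd_add {n : ℕ} {f g : (Fin n → ℝ) → ℝ} (hf : Sm f) (hg : Sm g) (i : Fin n) :
    pd i (fun x => f x + g x) = fun x => pd i f x + pd i g x := by
  funext x
  unfold pd
  rw [fderiv_fun_add (hf.differentiable' x) (hg.differentiable' x)]
  rfl

lemma pd_smul {n : ℕ} {f : (Fin n → ℝ) → ℝ} (hf : Sm f) (c : ℝ) (i : Fin n) :
    pd i (fun x => c * f x) = fun x => c * pd i f x := by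
  funext x
  unfold pd
  rw [fderiv_const_mul (hf.differentiable' x)]
  rfl

lemma pdL_add {n : ℕ} {f g : (Fin n → ℝ) → ℝ} (hf : Sm f) (hg : Sm g) (l : List (Fin n)) :
    pdL l (fun x => f x + g x) = fun x => pdL l f x + pdL l g x := by
  induction l with
  | nil => rfl
  | cons i l ih => rw [pdL, ih, pd_add (hf.pdL l) (hg.pdL l)]; rfl

lemma pdL_smul {n : ℕ} {f : (Fin n → ℝ) → ℝ} (hf : Sm f) (c : ℝ) (l : List (Fin n)) :
    pdL l (fun x => c * f x) = fun x => c * pdL l f x := by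
  induction l with
  | nil => rfl
  | cons i l ih => rw [pdL, ih, pd_smul (hf.pdL l)]; rfl

lemma pdL_sum {n : ℕ} {ι : Type*} (S : Finset ι) {f : ι → (Fin n → ℝ) → ℝ} (hf : ∀ i, Sm (f i))
    (l : List (Fin n)) :
    pdL l (fun x => ∑ i ∈ S, f i x) = fun x => ∑ i ∈ S, pdL l (f i) x := by
  classical
  induction S using Finset.induction_on with
  | empty =>
    simp only [Finset.sum_empty]
    have := pdL_smul (f := fun _ : Fin n → ℝ => (0:ℝ)) contDiff_const 0 l
    simpa using this
  | insert a S ha ih =>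
    simp only [Finset.sum_insert ha]
    rw [pdL_add (hf a) (ContDiff.sum fun i _ => hf i), ih]

/-- affine rescaling -/
lemma pdL_scale {n : ℕ} {f : (Fin n → ℝ) → ℝ} (hf : Sm f) (c : ℝ) (x0 : Fin n → ℝ)
    (l : List (Fin n)) : pdL l (fun x => f (c • (x - x0))) =
      fun x => c ^ l.length * pdL l f (c • (x - x0)) := by
  induction l with
  | nil => simp [pdL]
  | cons i l ih =>
    rw [pdL, ih]
    have hg : Sm (fun x => pdL l f (c • (x - x0))) :=
      (hf.pdL l).comp (contDiff_const_smul c |>.comp (contDiff_id.sub contDiff_const))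
    rw [pd_smul hg]
    funext x
    have h1 : HasFDerivAt (fun x : Fin n → ℝ => c • (x - x0))
        (c • ContinuousLinearMap.id ℝ (Fin n → ℝ)) x :=
      ((hasFDerivAt_id x).sub_const x0).const_smul c
    have h2 := ((hf.pdL l).differentiable' (c • (x - x0))).hasFDerivAt.comp x h1
    simp only [List.length_cons, pdL, pd]
    have h3 : fderiv ℝ (fun x => pdL l f (c • (x - x0))) x =
      (fderiv ℝ (pdL l f) (c • (x - x0))).comp (c • ContinuousLinearMap.id ℝ (Fin n → ℝ)) :=
      h2.fderiv
    rw [h3]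
    simp
    ring

/-- local vanishing -/
lemma pdL_congr {n : ℕ} {f g : (Fin n → ℝ) → ℝ} {U : Set (Fin n → ℝ)} (hU : IsOpen U)
    (h : ∀ x ∈ U, f x = g x) (l : List (Fin n)) : ∀ x ∈ U, pdL l f x = pdL l g x := by
  induction l with
  | nil => exact h
  | cons i l ih =>
    intro x hx
    simp only [pdL, pd]
    rw [Filter.EventuallyEq.fderiv_eq]
    filter_upwards [hU.mem_nhds hx] with y hy using ih y hy

lemma pdL_zero {n : ℕ} (l : List (Fin n)) : pdL l (fun _ : Fin n → ℝ => (0:ℝ)) = fun _ => 0 := by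
  have := pdL_smul (f := fun _ : Fin n → ℝ => (0:ℝ)) contDiff_const 0 l
  simpa using this

lemma pdL_const {n : ℕ} (c : ℝ) (l : List (Fin n)) (hl : l ≠ []) :
    pdL l (fun _ : Fin n → ℝ => c) = fun _ => 0 := by
  induction l with
  | nil => exact absurd rfl hl
  | cons i l ih =>
    by_cases h : l = []
    · subst h; funext x; simp [pdL, pd]
    · rw [pdL, ih h]; funext x; simp [pd]

/-- the jet of a tuple of functions -/
noncomputable def jt {n m : ℕ} (t : ℕ) (Y : Fin m → (Fin n → ℝ) → ℝ) (x : Fin n → ℝ) :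
    Jet n m t := (x, fun q => pdL (mlist q.2.1) (Y q.1) x)

/-- vertical jet of a variation in one component -/
noncomputable def jv {n m : ℕ} (t : ℕ) (ν : Fin m) (ψ : (Fin n → ℝ) → ℝ) (x : Fin n → ℝ) :
    Jet n m t := (0, fun q => if q.1 = ν then pdL (mlist q.2.1) ψ x else 0)

lemma projJet_jt {n m : ℕ} {s t : ℕ} (h : s ≤ t) (Y : Fin m → (Fin n → ℝ) → ℝ) (x : Fin n → ℝ) :
    projJet h (jt t Y x) = jt s Y x := rfl

lemma Sm.jt {n m : ℕ} (t : ℕ) {Y : Fin m → (Fin n → ℝ) → ℝ} (hY : ∀ σ, Sm (Y σ)) :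
    Sm (jt t Y) :=
  contDiff_id.prodMk (contDiff_pi.2 fun q => (hY q.1).pdL _)

lemma Sm.jv {n m : ℕ} (t : ℕ) (ν : Fin m) {ψ : (Fin n → ℝ) → ℝ} (hψ : Sm ψ) :
    Sm (jv t ν ψ) := by
  refine contDiff_const.prodMk (contDiff_pi.2 fun q => ?_)
  by_cases h : q.1 = ν
  · simpa only [h, if_true] using hψ.pdL _
  · simpa only [h, if_false] using contDiff_const

lemma jt_add {n m : ℕ} (t : ℕ) {Y : Fin m → (Fin n → ℝ) → ℝ} (hY : ∀ σ, Sm (Y σ))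
    (ν : Fin m) {ψ : (Fin n → ℝ) → ℝ} (hψ : Sm ψ) (ε : ℝ) (x : Fin n → ℝ) :
    jt t (fun σ x => Y σ x + (if σ = ν then ε else 0) * ψ x) x = jt t Y x + ε • jv t ν ψ x := by
  refine Prod.ext ?_ (funext fun q => ?_)
  · simp [jt, jv]
  · simp only [jt, jv]
    rw [pdL_add (hY _) (contDiff_const.mul hψ), pdL_smul hψ]
    by_cases h : q.1 = ν <;> simp [h]

/-- decomposition of a vertical derivative -/
lemma fderiv_decomp {n m t : ℕ} (g : Jet n m t → ℝ) (p v : Jet n m t) :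
    fderiv ℝ g p v = fderiv ℝ g p (v.1, 0) + ∑ q : JIdx n m t, v.2 q * pdY q.1 q.2.1 g p := by
  classical
  have h1 : v = (v.1, 0) + ∑ q : JIdx n m t, v.2 q • ((0, Pi.single q 1) : Jet n m t) := by
    refine Prod.ext ?_ (funext fun q => ?_)
    · simp [Prod.fst_sum]
    · simp [Prod.snd_sum, Finset.sum_apply, Pi.single_apply]
  conv_lhs => rw [h1]
  rw [map_add, map_sum]
  congr 1
  refine Finset.sum_congr rfl fun q _ => ?_
  rw [map_smul, smul_eq_mul, pdY, dif_pos q.2.2]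

lemma Sm.pdY {n m t : ℕ} {g : Jet n m t → ℝ} (hg : Sm g) (σ : Fin m) (J : Fin n → ℕ) :
    Sm (pdY σ J g) := by
  by_cases h : (∑ i, J i) ≤ t
  · have : JetVar.pdY σ J g = fun p => fderiv ℝ g p (0, Pi.single (σ, (⟨J, h⟩ : MD n t)) 1) := by
      funext p; rw [JetVar.pdY, dif_pos h]
    rw [this]; exact hg.dd _
  · have : JetVar.pdY σ J g = fun p => 0 := by
      funext p; rw [JetVar.pdY, dif_neg h]
    rw [this]; exact contDiff_const

lemma Sm.projJet {n m s t : ℕ} (h : s ≤ t) : Sm (projJet h : Jet n m t → Jet n m s) := by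
  exact contDiff_fst.prodMk (contDiff_pi.2 fun q =>
    (contDiff_apply ℝ ℝ _).comp contDiff_snd)

lemma Sm.yc {n m t : ℕ} (σ : Fin m) (J : Fin n → ℕ) : Sm (fun p : Jet n m t => yc σ J p) := by
  unfold JetVar.yc
  by_cases h : (∑ i, J i) ≤ t
  · simp only [h, dif_pos]; exact (contDiff_apply ℝ ℝ _).comp contDiff_snd
  · simp only [h]; exact contDiff_const

lemma Sm.formalD {n m t : ℕ} {g : Jet n m t → ℝ} (hg : Sm g) (i : Fin n) : Sm (formalD i g) := by
  have h1 : Sm (pdX i g) := hg.dd _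
  exact (h1.comp (Sm.projJet _)).add (ContDiff.sum fun q _ => (Sm.yc _ _).mul
    ((hg.pdY _ _).comp (Sm.projJet _)))

lemma Sm.formalDL {n m t : ℕ} {g : Jet n m t → ℝ} (hg : Sm g) (l : List (Fin n)) :
    Sm (formalDL l g) := by
  induction l with
  | nil => exact hg
  | cons i l ih => exact ih.formalD i

lemma formalD_jt {n m t : ℕ} {g : Jet n m t → ℝ} (hg : Sm g) (i : Fin n)
    {Y : Fin m → (Fin n → ℝ) → ℝ} (hY : ∀ σ, Sm (Y σ)) (x : Fin n → ℝ) :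
    formalD i g (jt (t+1) Y x) = pd i (fun x => g (jt t Y x)) x := by
  have h1 : HasFDerivAt (jt t Y) (fderiv ℝ (jt t Y) x) x :=
    ((Sm.jt t hY).differentiable' x).hasFDerivAt
  have h2 := ((hg.differentiable') (jt t Y x)).hasFDerivAt.comp x h1
  have h3 : HasFDerivAt (jt t Y) ((ContinuousLinearMap.id ℝ (Fin n → ℝ)).prod
      (ContinuousLinearMap.pi fun q : JIdx n m t => fderiv ℝ (pdL (mlist q.2.1) (Y q.1)) x)) x :=
    (hasFDerivAt_id x).prodMk (hasFDerivAt_pi.2 fun q =>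
      (((hY q.1).pdL _).differentiable' x).hasFDerivAt)
  have h4 : pd i (fun x => g (jt t Y x)) x = fderiv ℝ g (jt t Y x) (fderiv ℝ (jt t Y) x
      (Pi.single i 1)) := by
    rw [pd]
    have : fderiv ℝ (fun x => g (jt t Y x)) x = (fderiv ℝ g (jt t Y x)).comp
      (fderiv ℝ (jt t Y) x) := h2.fderiv
    rw [this]; rfl
  rw [h4, h3.fderiv, fderiv_decomp]
  simp only [formalD, projJet_jt]
  congr 1
  refine Finset.sum_congr rfl fun q _ => ?_
  congr 1
  have hle : ∑ j, addE q.2.1 i j ≤ t + 1 := by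
    rw [addE_sum]; have := q.2.2; omega
  rw [yc, dif_pos hle]
  simp only [jt]
  rw [pdL_perm (hY _) (mlist_addE _ _)]
  rfl

lemma formalDL_jt {n m t : ℕ} {g : Jet n m t → ℝ} (hg : Sm g) (l : List (Fin n))
    {Y : Fin m → (Fin n → ℝ) → ℝ} (hY : ∀ σ, Sm (Y σ)) (x : Fin n → ℝ) :
    formalDL l g (jt (t+l.length) Y x) = pdL l (fun x => g (jt t Y x)) x := by
  induction l generalizing x with
  | nil => rfl
  | cons i l ih =>
    have := formalD_jt (hg.formalDL l) i hY x
    rw [pdL]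
    simp only [ih] at this
    exact this

lemma EL_jt {n m r : ℕ} {L : Jet n m r → ℝ} (hL : Sm L) (σ : Fin m)
    {Y : Fin m → (Fin n → ℝ) → ℝ} (hY : ∀ σ, Sm (Y σ)) (x : Fin n → ℝ) :
    EL σ L (jt (2*r) Y x) = ∑ J : MD n r, (-1:ℝ)^(mlist J.1).length *
      pdL (mlist J.1) (fun x => pdY σ J.1 L (jt r Y x)) x := by
  rw [EL, LieEuler]
  refine Finset.sum_congr rfl fun J _ => ?_
  have h0 : (fun i => 0 + J.1 i) = J.1 := by funext i; simp
  have h : (∑ i, (0 + J.1 i)) ≤ r := by simpa using J.2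
  rw [dif_pos h, mlist_length]
  simp only [Nat.choose_zero_right, Nat.cast_one, Finset.prod_const_one, mul_one]
  congr 1
  rw [projJet_jt, formalDI, projJet_jt, formalDL_jt (hL.pdY _ _) _ hY]
  simp only [h0]

end JetVar


namespace JetVar
open MeasureTheory

lemma fderiv_fderiv_apply {E F : Type*} [NormedAddCommGroup E] [NormedSpace ℝ E]
    [NormedAddCommGroup F] [NormedSpace ℝ F] {f : E → F} (hf : Sm f) (v w x : E) :
    fderiv ℝ (fun y => fderiv ℝ f y v) x w = fderiv ℝ (fderiv ℝ f) x w v := by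
  have h1 : DifferentiableAt ℝ (fderiv ℝ f) x :=
    ((hf.fderiv_right (m := (⊤:ℕ∞)) (by simp)).differentiable (by simp)) x
  rw [fderiv_clm_apply h1 (differentiableAt_const v)]
  simp

lemma Sm.fderiv' {E F : Type*} [NormedAddCommGroup E] [NormedSpace ℝ E]
    [NormedAddCommGroup F] [NormedSpace ℝ F] {f : E → F} (hf : Sm f) : Sm (fderiv ℝ f) :=
  hf.fderiv_right (m := (⊤:ℕ∞)) (by simp)

lemma pdL_tsupport {n : ℕ} (g : (Fin n → ℝ) → ℝ) (l : List (Fin n)) (x : Fin n → ℝ)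
    (hx : x ∉ tsupport g) : pdL l g x = 0 := by
  have := pdL_congr (isClosed_tsupport g).isOpen_compl (g := fun _ => 0)
    (fun y hy => image_eq_zero_of_notMem_tsupport hy) l x hx
  rw [this, pdL_zero]

lemma pdL_hcs {n : ℕ} {g : (Fin n → ℝ) → ℝ} (hg : HasCompactSupport g) (l : List (Fin n)) :
    HasCompactSupport (pdL l g) :=
  HasCompactSupport.intro hg (fun x hx => pdL_tsupport g l x hx)

lemma jv_tsupport {n m : ℕ} (t : ℕ) (ν : Fin m) (ψ : (Fin n → ℝ) → ℝ) (x : Fin n → ℝ)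
    (hx : x ∉ tsupport ψ) : jv t ν ψ x = 0 := by
  refine Prod.ext rfl (funext fun q => ?_)
  simp [jv, pdL_tsupport ψ _ x hx]

lemma mlist_zero {n : ℕ} : mlist (fun _ : Fin n => 0) = [] := by
  rw [← List.length_eq_zero_iff, mlist_length]; simp

lemma jt_mem {n m : ℕ} (t : ℕ) (Y : Fin m → (Fin n → ℝ) → ℝ) (x : Fin n → ℝ)
    (W : Set (((Fin n) → ℝ) × ((Fin m) → ℝ))) :
    jt t Y x ∈ Dset t W ↔ (x, fun σ => Y σ x) ∈ W := by
  have : (fun σ => yc σ (fun _ => 0) (jt t Y x)) = fun σ => Y σ x := by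
    funext σ
    rw [yc, dif_pos (by simp)]
    simp only [jt, mlist_zero]; rfl
  simp only [Dset, Set.mem_ofPred_eq, this]; rfl

/-- integration by parts -/
lemma ibp {n : ℕ} {f χ : (Fin n → ℝ) → ℝ} (hf : Sm f) (hχ : Sm χ) (hc : HasCompactSupport χ)
    (l : List (Fin n)) :
    ∫ x, f x * pdL l χ x = (-1:ℝ)^l.length * ∫ x, pdL l f x * χ x := by
  induction l generalizing f with
  | nil => simp [pdL]
  | cons i l ih =>
    have hg := hχ.pdL l
    have hgc := pdL_hcs hc l
    have h1 : ∫ x, f x * fderiv ℝ (pdL l χ) x (Pi.single i 1) =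
        - ∫ x, fderiv ℝ f x (Pi.single i 1) * pdL l χ x := by
      apply integral_mul_fderiv_eq_neg_fderiv_mul_of_integrable
      · exact ((hf.dd _).continuous.mul hg.continuous).integrable_of_hasCompactSupport hgc.mul_left
      · exact (hf.continuous.mul (hg.dd _).continuous).integrable_of_hasCompactSupport
          (pdL_hcs hc (i :: l)).mul_left
      · exact (hf.continuous.mul hg.continuous).integrable_of_hasCompactSupport hgc.mul_left
      · exact fun x _ => hf.differentiable' x
      · exact fun x _ => hg.differentiable' x
    have h2 := ih (hf.pd i)
    have h3 : pdL l (pd i f) = pd i (pdL l f) := by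
      have e1 : (i :: l).Perm (l ++ [i]) := (List.perm_append_singleton i l).symm
      have e2 : ∀ l : List (Fin n), pdL (l ++ [i]) f = pdL l (pd i f) := by
        intro l
        induction l with
        | nil => rfl
        | cons j l ih => simp only [List.cons_append, pdL, ih]
      rw [← e2, ← pdL_perm hf e1]; rfl
    rw [h3] at h2
    change ∫ x, f x * fderiv ℝ (pdL l χ) x (Pi.single i 1) = _
    rw [h1]
    change - ∫ x, pd i f x * pdL l χ x = _
    rw [h2, List.length_cons, pow_succ]
    simp only [pdL]
    ring

/-- differentiation under the integral sign -/
lemma dui {n : ℕ} {F F' : ℝ → (Fin n → ℝ) → ℝ} (hF : Continuous F.uncurry)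
    (hF' : Continuous F'.uncurry) (hd : ∀ ε x, HasDerivAt (fun ε => F ε x) (F' ε x) ε)
    {K : Set (Fin n → ℝ)} (hK : IsCompact K) (h0 : ∀ ε, ∀ x ∉ K, F ε x = 0) :
    HasDerivAt (fun ε => ∫ x, F ε x) (∫ x, F' 0 x) 0 := by
  have h0' : ∀ ε, ∀ x ∉ K, F' ε x = 0 := by
    intro ε x hx
    have h1 : HasDerivAt (fun ε => F ε x) 0 ε := by
      have : (fun ε => F ε x) = fun _ => 0 := funext fun ε => h0 ε x hx
      rw [this]; exact hasDerivAt_const _ _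
    exact (hd ε x).unique h1
  obtain ⟨M, hM⟩ := ((isCompact_closedBall (0:ℝ) 1).prod hK).bddAbove_image hF'.norm.continuousOn
  refine (hasDerivAt_integral_of_dominated_loc_of_deriv_le (s := Metric.closedBall (0:ℝ) 1)
    (bound := K.indicator fun _ => M)
    (Metric.closedBall_mem_nhds _ one_pos) ?_ ?_ ?_ ?_ ?_ ?_).2
  · exact Filter.Eventually.of_forall fun ε =>
      (hF.comp (Continuous.prodMk_right ε)).aestronglyMeasurable
  · exact (hF.comp (Continuous.prodMk_right (0:ℝ))).integrable_of_hasCompactSupport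
      (HasCompactSupport.intro hK fun x hx => h0 0 x hx)
  · exact (hF'.comp (Continuous.prodMk_right (0:ℝ))).aestronglyMeasurable
  · refine Filter.Eventually.of_forall fun x ε hε => ?_
    by_cases hx : x ∈ K
    · rw [Set.indicator_of_mem hx]
      exact hM ⟨(ε, x), ⟨hε, hx⟩, rfl⟩
    · rw [h0' ε x hx, norm_zero, Set.indicator_of_notMem hx]
  · exact (integrable_indicator_iff hK.measurableSet).2
      (integrableOn_const hK.measure_lt_top.ne)
  · exact Filter.Eventually.of_forall fun x ε _ => hd ε x

lemma jv_deriv {n m r : ℕ} (L : Jet n m r → ℝ) (p : Jet n m r) (σ : Fin m)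
    (χ : (Fin n → ℝ) → ℝ) (x : Fin n → ℝ) :
    fderiv ℝ L p (jv r σ χ x) = ∑ J : MD n r, pdY σ J.1 L p * pdL (mlist J.1) χ x := by
  rw [fderiv_decomp]
  have : ((jv r σ χ x).1, (0 : JIdx n m r → ℝ)) = 0 := rfl
  rw [this, map_zero, zero_add, Fintype.sum_prod_type, Finset.sum_eq_single σ]
  · refine Finset.sum_congr rfl fun J _ => ?_
    simp [jv, mul_comm]
  · intro b _ hb
    simp [jv, hb]
  · simp

/-- First variation formula. -/
lemma FV {n m r : ℕ} {L : Jet n m r → ℝ} {Tσ : Jet n m r → ℝ} (hL : Sm L) (σ : Fin m)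
    {W : Set (((Fin n) → ℝ) × ((Fin m) → ℝ))}
    (hEL : ∀ p ∈ Dset (n := n) (m := m) (2*r) W,
      EL σ L p = Tσ (projJet (by omega : r ≤ 2*r) p))
    {Y : Fin m → (Fin n → ℝ) → ℝ} (hY : ∀ σ, Sm (Y σ)) {χ : (Fin n → ℝ) → ℝ} (hχ : Sm χ)
    (hc : HasCompactSupport χ) (hdom : ∀ x ∈ tsupport χ, (x, fun σ => Y σ x) ∈ W) :
    ∫ x, fderiv ℝ L (jt r Y x) (jv r σ χ x) = ∫ x, Tσ (jt r Y x) * χ x := by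
  have hs : ∀ J : MD n r, Sm (fun x => pdY σ J.1 L (jt r Y x)) := fun J =>
    (hL.pdY _ _).comp (Sm.jt r hY)
  simp only [jv_deriv]
  rw [integral_finsetSum]
  · simp only [fun J : MD n r => ibp (hs J) hχ hc (mlist J.1), ← integral_const_mul]
    rw [← integral_finsetSum]
    · refine integral_congr_ae (Filter.Eventually.of_forall fun x => ?_)
      by_cases hx : x ∈ tsupport χ
      · have h1 := hEL (jt (2*r) Y x) ((jt_mem _ _ _ _).2 (hdom x hx))
        rw [EL_jt hL σ hY, projJet_jt] at h1
        simp only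
        rw [← h1, Finset.sum_mul]
        exact Finset.sum_congr rfl fun J _ => by ring
      · simp [image_eq_zero_of_notMem_tsupport hx]
    · intro J _
      exact Integrable.const_mul ((((hs J).pdL _).continuous.mul
        hχ.continuous).integrable_of_hasCompactSupport hc.mul_left) _
  · intro J _
    exact ((hs J).continuous.mul (hχ.pdL _).continuous).integrable_of_hasCompactSupport
      (pdL_hcs hc _).mul_left

lemma hasDerivAt_line {E F : Type*} [NormedAddCommGroup E] [NormedSpace ℝ E]
    [NormedAddCommGroup F] [NormedSpace ℝ F] {f : E → F} (hf : Sm f) (p v : E) (ε : ℝ) :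
    HasDerivAt (fun ε : ℝ => f (p + ε • v)) (fderiv ℝ f (p + ε • v) v) ε := by
  have h1 : HasDerivAt (fun ε : ℝ => p + ε • v) v ε := by
    simpa using ((hasDerivAt_id ε).smul_const v).const_add p
  exact (hf.differentiable' _).hasFDerivAt.comp_hasDerivAt ε h1

lemma SV1 {n m r : ℕ} {L : Jet n m r → ℝ} {Tσ : Jet n m r → ℝ} (hL : Sm L) (hT : Sm Tσ) (σ : Fin m)
    {W : Set (((Fin n) → ℝ) × ((Fin m) → ℝ))} (hW : IsOpen W)
    (hEL : ∀ p ∈ Dset (n := n) (m := m) (2*r) W,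
      EL σ L p = Tσ (projJet (by omega : r ≤ 2*r) p))
    {Y : Fin m → (Fin n → ℝ) → ℝ} (hY : ∀ σ, Sm (Y σ)) {χ : (Fin n → ℝ) → ℝ} (hχ : Sm χ)
    (hc : HasCompactSupport χ) (hdom : ∀ x ∈ tsupport χ, (x, fun σ => Y σ x) ∈ W)
    (ν : Fin m) {ψ : (Fin n → ℝ) → ℝ} (hψ : Sm ψ) :
    ∫ x, fderiv ℝ (fderiv ℝ L) (jt r Y x) (jv r ν ψ x) (jv r σ χ x) =
      ∫ x, fderiv ℝ Tσ (jt r Y x) (jv r ν ψ x) * χ x := by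
  have cjt := (Sm.jt r hY).continuous
  have cψ := (Sm.jv r ν hψ).continuous
  have cχ := (Sm.jv r σ hχ).continuous
  have cp : Continuous (fun z : ℝ × (Fin n → ℝ) => jt r Y z.2 + z.1 • jv r ν ψ z.2) := by fun_prop
  have d1 := dui (F := fun ε x => fderiv ℝ L (jt r Y x + ε • jv r ν ψ x) (jv r σ χ x))
    (F' := fun ε x => fderiv ℝ (fderiv ℝ L) (jt r Y x + ε • jv r ν ψ x) (jv r ν ψ x) (jv r σ χ x))
    ((hL.fderiv'.continuous.comp cp).clm_apply (cχ.comp continuous_snd))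
    (((hL.fderiv'.fderiv'.continuous.comp cp).clm_apply (cψ.comp continuous_snd)).clm_apply
      (cχ.comp continuous_snd))
    (fun ε x => by
      have := hasDerivAt_line (hL.dd (jv r σ χ x)) (jt r Y x) (jv r ν ψ x) ε
      rwa [fderiv_fderiv_apply hL] at this)
    hc (fun ε x hx => by rw [jv_tsupport r σ χ x hx, map_zero])
  have d2 := dui (F := fun ε x => Tσ (jt r Y x + ε • jv r ν ψ x) * χ x)
    (F' := fun ε x => fderiv ℝ Tσ (jt r Y x + ε • jv r ν ψ x) (jv r ν ψ x) * χ x)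
    ((hT.continuous.comp cp).mul (hχ.continuous.comp continuous_snd))
    (((hT.fderiv'.continuous.comp cp).clm_apply (cψ.comp continuous_snd)).mul
      (hχ.continuous.comp continuous_snd))
    (fun ε x => (hasDerivAt_line hT (jt r Y x) (jv r ν ψ x) ε).mul_const (χ x))
    hc (fun ε x hx => by rw [image_eq_zero_of_notMem_tsupport hx, mul_zero])
  have hev : ∀ᶠ ε in nhds (0:ℝ), ∀ x ∈ tsupport χ,
      (x, fun σ' => Y σ' x + (if σ' = ν then ε else 0) * ψ x) ∈ W := by
    apply IsCompact.eventually_forall_of_forall_eventually hc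
    intro x hx
    have hcont : Continuous (fun z : ℝ × (Fin n → ℝ) =>
        (z.2, fun σ' => Y σ' z.2 + (if σ' = ν then z.1 else 0) * ψ z.2)) := by
      refine continuous_snd.prodMk (continuous_pi fun σ' => ?_)
      refine ((hY σ').continuous.comp continuous_snd).add (Continuous.mul ?_
        (hψ.continuous.comp continuous_snd))
      by_cases h : σ' = ν
      · simpa [h] using continuous_fst
      · simpa [h] using continuous_const
    apply hcont.continuousAt.eventually_mem
    refine hW.mem_nhds ?_
    simpa using hdom x hx
  have heq : (fun ε : ℝ => ∫ x, fderiv ℝ L (jt r Y x + ε • jv r ν ψ x) (jv r σ χ x)) =ᶠ[nhds (0:ℝ)]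
      fun ε : ℝ => ∫ x, Tσ (jt r Y x + ε • jv r ν ψ x) * χ x := by
    filter_upwards [hev] with ε hε
    have := FV hL σ hEL (Y := fun σ' x => Y σ' x + (if σ' = ν then ε else 0) * ψ x)
      (fun σ' => (hY σ').add (contDiff_const.mul hψ)) hχ hc hε
    simpa only [jt_add r hY ν hψ] using this
  have := d1.unique (d2.congr_of_eventuallyEq heq)
  simpa using this

/-- Weak Helmholtz condition. -/
lemma WH {n m r : ℕ} {L : Jet n m r → ℝ} {T : Fin m → Jet n m r → ℝ} (hL : Sm L)
    (hT : ∀ σ, Sm (T σ))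
    {W : Set (((Fin n) → ℝ) × ((Fin m) → ℝ))} (hW : IsOpen W)
    (hEL : ∀ σ, ∀ p ∈ Dset (n := n) (m := m) (2*r) W,
      EL σ L p = T σ (projJet (by omega : r ≤ 2*r) p))
    {Y : Fin m → (Fin n → ℝ) → ℝ} (hY : ∀ σ, Sm (Y σ)) (σ ν : Fin m)
    {ψ : (Fin n → ℝ) → ℝ} (hψ : Sm ψ) (x0 : Fin n → ℝ) {ρ : ℝ} (hρ : 0 < ρ)
    (hψs : tsupport ψ ⊆ Metric.ball x0 ρ)
    (hdom : ∀ x ∈ Metric.closedBall x0 (2*ρ), (x, fun σ => Y σ x) ∈ W) :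
    ∫ x, fderiv ℝ (T σ) (jt r Y x) (jv r ν ψ x) =
      ∫ x, pdY σ (fun _ => 0) (T ν) (jt r Y x) * ψ x := by
  classical
  let bump : ContDiffBump x0 := ⟨ρ, 2*ρ, hρ, by linarith⟩
  have hχ : Sm (bump : (Fin n → ℝ) → ℝ) := bump.contDiff
  have hχc : HasCompactSupport (bump : (Fin n → ℝ) → ℝ) := bump.hasCompactSupport
  have hχs : tsupport (bump : (Fin n → ℝ) → ℝ) = Metric.closedBall x0 (2*ρ) := bump.tsupport_eq
  have hψc : HasCompactSupport ψ := by
    refine HasCompactSupport.of_support_subset_isCompact (isCompact_closedBall x0 ρ) ?_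
    exact (subset_tsupport ψ).trans (hψs.trans Metric.ball_subset_closedBall)
  have h1 := SV1 hL (hT σ) σ hW (hEL σ) hY hχ hχc (by rw [hχs]; exact hdom) ν hψ
  have h2 := SV1 hL (hT ν) ν hW (hEL ν) hY hψ hψc (fun x hx => hdom x (by
    have := hψs hx
    rw [Metric.mem_ball] at this
    rw [Metric.mem_closedBall]; linarith)) σ hχ
  have h3 : ∀ x, fderiv ℝ (fderiv ℝ L) (jt r Y x) (jv r ν ψ x) (jv r σ bump x) =
      fderiv ℝ (fderiv ℝ L) (jt r Y x) (jv r σ bump x) (jv r ν ψ x) := by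
    intro x
    rw [← fderiv_fderiv_apply hL, hL.symm2, fderiv_fderiv_apply hL]
  simp only [h3] at h1
  rw [h1] at h2
  have hone : ∀ x ∈ Metric.ball x0 ρ, (bump : (Fin n → ℝ) → ℝ) x = 1 := fun x hx =>
    bump.one_of_mem_closedBall (Metric.ball_subset_closedBall hx)
  have e1 : ∀ x, fderiv ℝ (T σ) (jt r Y x) (jv r ν ψ x) * bump x =
      fderiv ℝ (T σ) (jt r Y x) (jv r ν ψ x) := by
    intro x
    by_cases hx : x ∈ tsupport ψ
    · rw [hone x (hψs hx), mul_one]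
    · rw [jv_tsupport r ν ψ x hx, map_zero, zero_mul]
  have e2 : ∀ x, fderiv ℝ (T ν) (jt r Y x) (jv r σ bump x) * ψ x =
      pdY σ (fun _ => 0) (T ν) (jt r Y x) * ψ x := by
    intro x
    by_cases hx : x ∈ tsupport ψ
    · congr 1
      rw [jv_deriv, Finset.sum_eq_single (⟨fun _ => 0, by simp⟩ : MD n r)]
      · simp only [mlist_zero, pdL]
        rw [hone x (hψs hx), mul_one]
      · intro J _ hJ
        rw [pdL_congr Metric.isOpen_ball hone _ x (hψs hx), pdL_const, mul_zero]
        intro hl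
        apply hJ
        apply Subtype.ext
        funext i
        have := count_mlist J.1 i
        rw [hl] at this
        simpa using this.symm
      · simp
    · simp [image_eq_zero_of_notMem_tsupport hx]
  simpa only [e1, e2] using h2

end JetVar


namespace JetVar
open MeasureTheory

lemma integral_affine {n : ℕ} (G : (Fin n → ℝ) → ℝ) (x0 : Fin n → ℝ) (τ : ℝ) :
    ∫ z, G (x0 + τ • z) = |(τ ^ n)⁻¹| * ∫ x, G x := by
  have h1 := Measure.integral_comp_smul (volume : Measure (Fin n → ℝ)) (fun y => G (x0 + y)) τ
  simp only [smul_eq_mul, Module.finrank_fintype_fun_eq_card, Fintype.card_fin] at h1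
  rw [h1, integral_add_left_eq_self (fun y => G y) x0]

lemma cpi {n : ℕ} {F : ℝ → (Fin n → ℝ) → ℝ} (hF : Continuous F.uncurry)
    {K : Set (Fin n → ℝ)} (hK : IsCompact K) (h0 : ∀ ε, ∀ x ∉ K, F ε x = 0) :
    Continuous (fun ε => ∫ x, F ε x) := by
  have : (fun ε => ∫ x, F ε x) = fun ε => ∫ x in K, F ε x := by
    funext ε
    rw [setIntegral_eq_integral_of_forall_compl_eq_zero (h0 ε)]
  rw [this]
  exact continuous_parametric_integral_of_continuous hF hK

/-- one-variable normalized monomials -/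
noncomputable def hm (a : ℝ) (k : ℕ) (t : ℝ) : ℝ := (t - a)^k / (k.factorial : ℝ)

lemma hm_smooth (a : ℝ) (k : ℕ) : Sm (hm a k) := by
  unfold hm
  exact ((contDiff_id.sub contDiff_const).pow k).div_const _

lemma deriv_hm_succ (a : ℝ) (k : ℕ) : deriv (hm a (k+1)) = hm a k := by
  funext t
  have h1 : HasDerivAt (fun t : ℝ => (t - a)^(k+1) / ((k+1).factorial : ℝ))
      ((((k+1 : ℕ) : ℝ) * (t - a)^(k+1-1) * 1) / ((k+1).factorial : ℝ)) t :=
    (((hasDerivAt_id t).sub_const a).pow (k+1)).div_const _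
  have h2 : deriv (hm a (k+1)) t = _ := h1.deriv
  rw [h2, hm, Nat.factorial_succ]
  have : (k.factorial : ℝ) ≠ 0 := by positivity
  have : ((k:ℝ)+1) ≠ 0 := by positivity
  push_cast
  field_simp
  try simp

lemma deriv_hm_zero (a : ℝ) : deriv (hm a 0) = fun _ => 0 := by
  have : hm a 0 = fun _ => 1 := by funext t; simp [hm]
  rw [this]; funext t; simp

lemma iter_hm (a : ℝ) (c k : ℕ) : (deriv^[c] (hm a k)) a = if c = k then 1 else 0 := by
  induction c generalizing k with
  | zero =>
    rcases k with _ | k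
    · simp [hm]
    · simp [hm]
  | succ c ih =>
    rw [Function.iterate_succ_apply]
    rcases k with _ | k
    · rw [deriv_hm_zero]
      have : ∀ c : ℕ, deriv^[c] (fun _ : ℝ => (0:ℝ)) = fun _ => 0 := by
        intro c
        induction c with
        | zero => rfl
        | succ c ih => rw [Function.iterate_succ_apply]; simpa using ih
      rw [this]; simp
    · rw [deriv_hm_succ, ih]; simp

lemma Sm.deriv1 {g : ℝ → ℝ} (hg : Sm g) : Sm (deriv g) := by
  have : deriv g = fun x => fderiv ℝ g x 1 := by funext x; simp
  rw [this]; exact hg.dd 1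

lemma Sm.iter {g : ℝ → ℝ} (hg : Sm g) (c : ℕ) : Sm (deriv^[c] g) := by
  induction c with
  | zero => exact hg
  | succ c ih => rw [Function.iterate_succ_apply']; exact ih.deriv1

lemma pd_prod {n : ℕ} (g : Fin n → ℝ → ℝ) (hg : ∀ j, Sm (g j)) (i : Fin n) :
    pd i (fun x => ∏ j, g j (x j)) =
      fun x => ∏ j, (deriv^[if i = j then 1 else 0] (g j)) (x j) := by
  classical
  funext x
  have h1 : ∀ j ∈ Finset.univ, HasFDerivAt (fun x : Fin n → ℝ => g j (x j))
      ((deriv (g j) (x j)) • (ContinuousLinearMap.proj j : (Fin n → ℝ) →L[ℝ] ℝ)) x := by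
    intro j _
    exact ((hg j).differentiable' (x j)).hasDerivAt.comp_hasFDerivAt x
      (ContinuousLinearMap.proj (R := ℝ) (φ := fun _ : Fin n => ℝ) j).hasFDerivAt
  have h2 := HasFDerivAt.finsetProd h1
  rw [pd, h2.fderiv]
  simp only [ContinuousLinearMap.sum_apply, ContinuousLinearMap.smul_apply,
    ContinuousLinearMap.proj_apply, smul_eq_mul]
  rw [Finset.sum_eq_single i]
  · rw [← Finset.prod_erase_mul _ _ (Finset.mem_univ i)]
    congr 1
    · refine Finset.prod_congr rfl fun j hj => ?_
      rw [if_neg (Finset.ne_of_mem_erase hj).symm]; rfl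
    · simp
  · intro j _ hj; simp [hj]
  · simp

lemma pdL_prod {n : ℕ} (g : Fin n → ℝ → ℝ) (hg : ∀ j, Sm (g j)) (l : List (Fin n)) :
    pdL l (fun x => ∏ j, g j (x j)) = fun x => ∏ j, (deriv^[l.count j] (g j)) (x j) := by
  induction l with
  | nil => rfl
  | cons i l ih =>
    rw [pdL, ih, pd_prod _ (fun j => (hg j).iter _)]
    funext x
    refine Finset.prod_congr rfl fun j _ => ?_
    rw [← Function.iterate_add_apply, List.count_cons, add_comm]
    simp

/-- every jet is the jet of a smooth map -/
lemma exists_jet {n m r : ℕ} (p : Jet n m r) :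
    ∃ Y : Fin m → (Fin n → ℝ) → ℝ, (∀ σ, Sm (Y σ)) ∧ jt r Y p.1 = p := by
  classical
  have hs : ∀ K : Fin n → ℕ, Sm (fun x : Fin n → ℝ => ∏ j, hm (p.1 j) (K j) (x j)) := fun K =>
    contDiff_prod fun j _ => (hm_smooth _ _).comp (contDiff_apply ℝ ℝ j)
  refine ⟨fun σ x => ∑ K : MD n r, p.2 (σ, K) * ∏ j, hm (p.1 j) (K.1 j) (x j), fun σ =>
    ContDiff.sum fun K _ => contDiff_const.mul (hs K.1), ?_⟩
  refine Prod.ext rfl (funext fun q => ?_)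
  obtain ⟨σ, J⟩ := q
  simp only [jt]
  rw [pdL_sum (f := fun (K : MD n r) x => p.2 (σ, K) * ∏ j, hm (p.1 j) (K.1 j) (x j)) Finset.univ
    (fun K => contDiff_const.mul (hs K.1))]
  simp only
  rw [Finset.sum_eq_single J]
  · rw [pdL_smul (hs _), pdL_prod _ (fun j => hm_smooth _ _)]
    simp [iter_hm, count_mlist]
  · intro K _ hK
    rw [pdL_smul (hs _), pdL_prod _ (fun j => hm_smooth _ _)]
    simp only [iter_hm, count_mlist, mul_eq_zero]
    right
    have : ∃ j, J.1 j ≠ K.1 j := by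
      by_contra hcon
      push Not at hcon
      exact hK (Subtype.ext (funext fun j => (hcon j).symm))
    obtain ⟨j, hj⟩ := this
    exact Finset.prod_eq_zero (Finset.mem_univ j) (by rw [if_neg hj])
  · simp

/-- top-order part of a jet -/
noncomputable def topj {n m : ℕ} (r : ℕ) (φ : Fin m → (Fin n → ℝ) → ℝ) (z : Fin n → ℝ) :
    Jet n m r := (0, fun q => if ∑ i, q.2.1 i = r then pdL (mlist q.2.1) (φ q.1) z else 0)

lemma Sm.topj {n m : ℕ} (r : ℕ) {φ : Fin m → (Fin n → ℝ) → ℝ} (hφ : ∀ σ, Sm (φ σ)) :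
    Sm (topj r φ) := by
  refine contDiff_const.prodMk (contDiff_pi.2 fun q => ?_)
  by_cases h : ∑ i, q.2.1 i = r
  · simpa only [h, if_true] using (hφ _).pdL _
  · simpa only [h, if_false] using contDiff_const

lemma blowup {n m r : ℕ} (hr : 1 ≤ r) {L : Jet n m r → ℝ} {T : Fin m → Jet n m r → ℝ}
    (hL : Sm L) (hT : ∀ σ, Sm (T σ))
    {W : Set (((Fin n) → ℝ) × ((Fin m) → ℝ))} (hW : IsOpen W)
    (hEL : ∀ σ, ∀ p ∈ Dset (n := n) (m := m) (2*r) W,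
      EL σ L p = T σ (projJet (by omega : r ≤ 2*r) p))
    (σ ν : Fin m) {p : Jet n m r} (hp : p ∈ Dset r W)
    {ψ : (Fin n → ℝ) → ℝ} (hψ : Sm ψ) (hψs : tsupport ψ ⊆ Metric.closedBall 0 1)
    {φ : Fin m → (Fin n → ℝ) → ℝ} (hφ : ∀ σ, Sm (φ σ)) :
    ∫ z, ∑ K : MD n r, (if ∑ i, K.1 i = r then
      pdY ν K.1 (T σ) (p + topj r φ z) * pdL (mlist K.1) ψ z else 0) = 0 := by
  obtain ⟨Y, hY, hYp⟩ := exists_jet p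
  set x0 := p.1 with hx0
  let A : ℝ → (Fin n → ℝ) → Jet n m r := fun τ z => (x0 + τ • z, fun q =>
    pdL (mlist q.2.1) (Y q.1) (x0 + τ • z) + τ^(r - ∑ i, q.2.1 i) * pdL (mlist q.2.1) (φ q.1) z)
  let V : ℝ → (Fin n → ℝ) → Jet n m r := fun τ z => (0, fun q =>
    if q.1 = ν then τ^(r - ∑ i, q.2.1 i) * pdL (mlist q.2.1) ψ z else 0)
  have cx : Continuous (fun w : ℝ × (Fin n → ℝ) => x0 + w.1 • w.2) := by fun_prop
  have cA : Continuous A.uncurry := by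
    refine cx.prodMk (continuous_pi fun q => ?_)
    exact (((hY q.1).pdL _).continuous.comp cx).add ((continuous_fst.pow _).mul
      (((hφ q.1).pdL _).continuous.comp continuous_snd))
  have cV : Continuous V.uncurry := by
    refine continuous_const.prodMk (continuous_pi fun q => ?_)
    by_cases h : q.1 = ν
    · simp only [h, if_true]
      exact (continuous_fst.pow _).mul ((hψ.pdL _).continuous.comp continuous_snd)
    · simpa only [h, if_false] using continuous_const
  have hc : HasCompactSupport ψ := (isCompact_closedBall 0 1).of_isClosed_subset
    (isClosed_tsupport ψ) hψs
  let F : ℝ → (Fin n → ℝ) → ℝ := fun τ z => fderiv ℝ (T σ) (A τ z) (V τ z)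
  let G : ℝ → (Fin n → ℝ) → ℝ := fun τ z => pdY σ (fun _ => 0) (T ν) (A τ z) * (τ^r * ψ z)
  have hV0 : ∀ τ, ∀ z ∉ tsupport ψ, V τ z = 0 := by
    intro τ z hz
    refine Prod.ext rfl (funext fun q => ?_)
    simp [V, pdL_tsupport ψ _ z hz]
  have cF : Continuous fun τ => ∫ z, F τ z := by
    refine cpi (((hT σ).fderiv'.continuous.comp cA).clm_apply cV) hc ?_
    intro τ z hz
    simp only [F]
    rw [hV0 τ z hz, map_zero]
  have cG : Continuous fun τ => ∫ z, G τ z := by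
    refine cpi ((((hT ν).pdY _ _).continuous.comp cA).mul ((continuous_fst.pow _).mul
      (hψ.continuous.comp continuous_snd))) hc ?_
    intro τ z hz
    simp [G, image_eq_zero_of_notMem_tsupport hz]
  have hdom : ∀ᶠ τ in nhds (0:ℝ), ∀ z ∈ Metric.closedBall (0 : Fin n → ℝ) 4,
      (x0 + τ • z, fun σ => Y σ (x0 + τ • z) + τ^r * φ σ z) ∈ W := by
    apply IsCompact.eventually_forall_of_forall_eventually (isCompact_closedBall 0 4)
    intro z _
    have hcont : Continuous (fun w : ℝ × (Fin n → ℝ) =>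
        (x0 + w.1 • w.2, fun σ => Y σ (x0 + w.1 • w.2) + w.1^r * φ σ w.2)) := by
      refine cx.prodMk (continuous_pi fun σ => ?_)
      exact ((hY σ).continuous.comp cx).add ((continuous_fst.pow _).mul
        ((hφ σ).continuous.comp continuous_snd))
    apply hcont.continuousAt.eventually_mem
    refine hW.mem_nhds ?_
    have h0 : (0:ℝ)^r = 0 := zero_pow (by omega)
    simp only [h0, zero_smul, add_zero, zero_mul]
    rw [← hYp] at hp
    exact (jt_mem _ _ _ _).1 hp
  have hev : ∀ᶠ τ in nhdsWithin (0:ℝ) (Set.Ioi 0), ∫ z, F τ z = ∫ z, G τ z := by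
    filter_upwards [nhdsWithin_le_nhds hdom, self_mem_nhdsWithin] with τ hτ hpos
    have hpos : 0 < τ := hpos
    have hne : τ ≠ 0 := hpos.ne'
    have sm1 : Sm (fun x : Fin n → ℝ => τ⁻¹ • (x - x0)) :=
      contDiff_const_smul _ |>.comp (contDiff_id.sub contDiff_const)
    let Yt : Fin m → (Fin n → ℝ) → ℝ := fun σ x => Y σ x + τ^r * φ σ (τ⁻¹ • (x - x0))
    let ψt : (Fin n → ℝ) → ℝ := fun x => τ^r * ψ (τ⁻¹ • (x - x0))
    have hYt : ∀ σ, Sm (Yt σ) := fun σ => (hY σ).add (contDiff_const.mul ((hφ σ).comp sm1))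
    have hψt : Sm ψt := contDiff_const.mul (hψ.comp sm1)
    have hts : tsupport ψt ⊆ Metric.ball x0 (2*τ) := by
      refine (closure_minimal ?_ Metric.isClosed_closedBall).trans
        (Metric.closedBall_subset_ball (by linarith : τ < 2*τ))
      intro x hx
      have h1 : ψ (τ⁻¹ • (x - x0)) ≠ 0 := by
        intro h; apply hx; simp [ψt, h]
      have h2 := hψs (subset_tsupport ψ h1)
      rw [mem_closedBall_zero_iff, norm_smul, norm_inv, Real.norm_of_nonneg hpos.le,
        inv_mul_le_iff₀ hpos, mul_one] at h2
      rwa [mem_closedBall_iff_norm]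
    have hd : ∀ x ∈ Metric.closedBall x0 (2 * (2*τ)), (x, fun σ => Yt σ x) ∈ W := by
      intro x hx
      have h1 : τ⁻¹ • (x - x0) ∈ Metric.closedBall (0 : Fin n → ℝ) 4 := by
        rw [mem_closedBall_zero_iff, norm_smul, norm_inv, Real.norm_of_nonneg hpos.le,
          inv_mul_le_iff₀ hpos]
        rw [mem_closedBall_iff_norm] at hx
        linarith
      have h2 := hτ _ h1
      rw [smul_inv_smul₀ hne, add_sub_cancel] at h2
      exact h2
    have hwh := WH hL hT hW hEL hYt σ ν hψt x0 (by linarith : 0 < 2*τ) hts hd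
    have hz : ∀ z : Fin n → ℝ, τ⁻¹ • (x0 + τ • z - x0) = z := by
      intro z; rw [add_sub_cancel_left, inv_smul_smul₀ hne]
    have hpow : ∀ k ≤ r, τ^r * (τ⁻¹)^k = τ^(r-k) := by
      intro k hk
      rw [inv_pow, pow_sub₀ _ hne hk]
    have eA : ∀ z, jt r Yt (x0 + τ • z) = A τ z := by
      intro z
      refine Prod.ext rfl (funext fun q => ?_)
      simp only [jt, A, Yt]
      rw [pdL_add (hY _) (g := fun x => τ^r * φ q.1 (τ⁻¹ • (x - x0))) (contDiff_const.mul ((hφ _).comp sm1)),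
        pdL_smul (f := fun x => φ q.1 (τ⁻¹ • (x - x0))) ((hφ _).comp sm1)]
      have := pdL_scale (hφ q.1) τ⁻¹ x0 (mlist q.2.1)
      rw [this]
      simp only [hz]
      rw [← mul_assoc, mlist_length, hpow _ q.2.2]
    have eV : ∀ z, jv r ν ψt (x0 + τ • z) = V τ z := by
      intro z
      refine Prod.ext rfl (funext fun q => ?_)
      simp only [jv, V, ψt]
      congr 1
      rw [pdL_smul (f := fun x => ψ (τ⁻¹ • (x - x0))) (hψ.comp sm1)]
      have := pdL_scale hψ τ⁻¹ x0 (mlist q.2.1)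
      rw [this]
      simp only [hz]
      rw [← mul_assoc, mlist_length, hpow _ q.2.2]
    have i1 := integral_affine (fun x => fderiv ℝ (T σ) (jt r Yt x) (jv r ν ψt x)) x0 τ
    have i2 := integral_affine (fun x => pdY σ (fun _ => 0) (T ν) (jt r Yt x) * ψt x) x0 τ
    rw [hwh, ← i2] at i1
    simp only [eA, eV, ψt, hz] at i1
    exact i1
  have hlim : ∫ z, F 0 z = ∫ z, G 0 z := by
    have t1 := (cF.tendsto 0).mono_left (nhdsWithin_le_nhds (s := Set.Ioi 0))
    have t2 := (cG.tendsto 0).mono_left (nhdsWithin_le_nhds (s := Set.Ioi 0))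
    exact tendsto_nhds_unique (t1.congr' hev) t2
  have hG0 : ∫ z, G 0 z = 0 := by
    have h0 : (0:ℝ)^r = 0 := zero_pow (by omega)
    simp [G, h0]
  rw [hG0] at hlim
  refine Eq.trans ?_ hlim
  refine integral_congr_ae (Filter.Eventually.of_forall fun z => ?_)
  have h0 : ∀ K : MD n r, (0:ℝ)^(r - ∑ i, K.1 i) = if ∑ i, K.1 i = r then 1 else 0 := by
    intro K
    have := K.2
    split_ifs with h
    · simp [h]
    · exact zero_pow (by omega)
  have eA : A 0 z = p + topj r φ z := by
    rw [← hYp]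
    refine Prod.ext ?_ (funext fun q => ?_)
    · simp [A, jt, topj]
    · simp [A, jt, topj, h0]
  simp only [F]
  symm
  rw [fderiv_decomp]
  have : ((V 0 z).1, (0 : JIdx n m r → ℝ)) = 0 := rfl
  rw [this, map_zero, zero_add, Fintype.sum_prod_type, Finset.sum_eq_single ν]
  · refine Finset.sum_congr rfl fun K _ => ?_
    simp only [V, eA, if_true, h0]
    split_ifs <;> ring
  · intro b _ hb
    simp [V, hb]
  · simp

end JetVar


namespace JetVar
open MeasureTheory

/-- exponentials -/
noncomputable def ex {n : ℕ} (ξ z : Fin n → ℝ) : ℝ := Real.exp (∑ i, ξ i * z i)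

lemma ex_smooth {n : ℕ} (ξ : Fin n → ℝ) : Sm (ex ξ) := by
  unfold ex
  exact Real.contDiff_exp.comp (ContDiff.sum fun i _ => contDiff_const.mul (contDiff_apply ℝ ℝ i))

lemma ex_add {n : ℕ} (ξ η z : Fin n → ℝ) : ex (ξ + η) z = ex ξ z * ex η z := by
  simp only [ex, ← Real.exp_add, Pi.add_apply, add_mul, Finset.sum_add_distrib]

lemma pd_ex {n : ℕ} (ξ : Fin n → ℝ) (i : Fin n) : pd i (ex ξ) = fun z => ξ i * ex ξ z := by
  classical
  funext z
  have h1 : HasFDerivAt (fun z : Fin n → ℝ => ∑ i, ξ i * z i)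
      (∑ i, ξ i • (ContinuousLinearMap.proj i : (Fin n → ℝ) →L[ℝ] ℝ)) z := by
    refine HasFDerivAt.fun_sum fun i _ => ?_
    exact (ContinuousLinearMap.proj (R := ℝ) (φ := fun _ : Fin n => ℝ) i).hasFDerivAt.const_mul (ξ i)
  have h2 : HasFDerivAt (ex ξ) _ z := h1.exp
  rw [pd, h2.fderiv]
  simp [ex, Pi.single_apply, mul_comm]

lemma pdL_ex {n : ℕ} (ξ : Fin n → ℝ) (l : List (Fin n)) :
    pdL l (ex ξ) = fun z => (∏ j, ξ j ^ l.count j) * ex ξ z := by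
  induction l with
  | nil => simp [pdL]
  | cons i l ih =>
    rw [pdL, ih, pd_smul (ex_smooth ξ), pd_ex]
    funext z
    simp only [List.count_cons, pow_add, Finset.prod_mul_distrib]
    have : ∏ j, ξ j ^ (if (i == j) = true then 1 else 0) = ξ i := by
      rw [Finset.prod_eq_single i]
      · simp
      · intro j _ hj; simp [Ne.symm hj]
      · simp
    rw [this]; ring

/-- the top-order rank-one direction -/
noncomputable def wv {n m : ℕ} (r : ℕ) (ν : Fin m) (ξ : Fin n → ℝ) : Jet n m r :=
  (0, fun q => if q.1 = ν ∧ ∑ i, q.2.1 i = r then ∏ i, ξ i ^ q.2.1 i else 0)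

lemma wv_smul {n m : ℕ} (r : ℕ) (ν : Fin m) (ξ : Fin n → ℝ) (c : ℝ) :
    wv r ν (c • ξ) = c ^ r • wv r ν ξ := by
  refine Prod.ext (by simp [wv]) (funext fun q => ?_)
  simp only [wv, Prod.smul_snd, Pi.smul_apply, smul_eq_mul]
  split_ifs with h
  · simp only [mul_pow, Finset.prod_mul_distrib, Finset.prod_pow_eq_pow_sum, h.2]
  · simp

lemma wv_deriv {n m r : ℕ} (g : Jet n m r → ℝ) (p : Jet n m r) (ν : Fin m) (ξ : Fin n → ℝ) :
    fderiv ℝ g p (wv r ν ξ) = ∑ K : MD n r,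
      (if ∑ i, K.1 i = r then ∏ i, ξ i ^ K.1 i else 0) * pdY ν K.1 g p := by
  rw [fderiv_decomp]
  have : ((wv r ν ξ).1, (0 : JIdx n m r → ℝ)) = 0 := rfl
  rw [this, map_zero, zero_add, Fintype.sum_prod_type, Finset.sum_eq_single ν]
  · refine Finset.sum_congr rfl fun J _ => ?_
    simp [wv]
  · intro b _ hb
    simp [wv, hb]
  · simp

/-- iterated directional derivatives -/
noncomputable def ddL {E : Type*} [NormedAddCommGroup E] [NormedSpace ℝ E] :
    List E → (E → ℝ) → E → ℝ
  | [], f => f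
  | v :: l, f => fun p => fderiv ℝ (ddL l f) p v

lemma Sm.ddL {E : Type*} [NormedAddCommGroup E] [NormedSpace ℝ E] {f : E → ℝ} (hf : Sm f)
    (l : List E) : Sm (ddL l f) := by
  induction l with
  | nil => exact hf
  | cons v l ih => exact ih.dd v

lemma ddL_sum {E : Type*} [NormedAddCommGroup E] [NormedSpace ℝ E] {ι : Type*} [Fintype ι]
    (c : ι → ℝ) {f : ι → E → ℝ} (hf : ∀ i, Sm (f i)) (l : List E) :
    ddL l (fun p => ∑ i, c i * f i p) = fun p => ∑ i, c i * ddL l (f i) p := by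
  induction l with
  | nil => rfl
  | cons v l ih =>
    rw [ddL, ih]
    funext p
    have h : HasFDerivAt (fun p => ∑ i, c i * ddL l (f i) p)
        (∑ i, c i • fderiv ℝ (ddL l (f i)) p) p := by
      refine HasFDerivAt.fun_sum fun i _ => ?_
      exact (((hf i).ddL l).differentiable' p).hasFDerivAt.const_mul (c i)
    rw [h.fderiv]
    simp [ddL]

lemma ddL_append {E : Type*} [NormedAddCommGroup E] [NormedSpace ℝ E] (f : E → ℝ)
    (l l' : List E) : ddL (l ++ l') f = ddL l (ddL l' f) := by
  induction l with
  | nil => rfl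
  | cons v l ih => simp only [List.cons_append, ddL, ih]

lemma ddL_ofFn {E : Type*} [NormedAddCommGroup E] [NormedSpace ℝ E] {f : E → ℝ} (hf : Sm f)
    {k : ℕ} (v : Fin k → E) (p : E) : ddL (List.ofFn v) f p = iteratedFDeriv ℝ k f p v := by
  induction k generalizing p with
  | zero => simp [ddL]
  | succ k ih =>
    rw [List.ofFn_succ, iteratedFDeriv_succ_apply_left]
    simp only [ddL]
    have h1 : ddL (List.ofFn fun i : Fin k => v i.succ) f =
        fun q => iteratedFDeriv ℝ k f q (Fin.tail v) := by
      funext q; exact ih (Fin.tail v) q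
    rw [h1]
    have h2 : DifferentiableAt ℝ (iteratedFDeriv ℝ k f) p :=
      (hf.differentiable_iteratedFDeriv (by exact_mod_cast WithTop.coe_lt_top (k : ℕ)  )) p
    have h3 := (ContinuousMultilinearMap.apply ℝ (fun _ : Fin k => E) ℝ
      (Fin.tail v)).hasFDerivAt.comp p h2.hasFDerivAt
    have h4 : fderiv ℝ (fun q => iteratedFDeriv ℝ k f q (Fin.tail v)) p = _ := h3.fderiv
    rw [h4]
    rfl

lemma topj_add {n m : ℕ} (r : ℕ) {φ : Fin m → (Fin n → ℝ) → ℝ} (hφ : ∀ σ, Sm (φ σ))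
    (μ : Fin m) (ξ : Fin n → ℝ) (ε : ℝ) (z : Fin n → ℝ) :
    topj r (fun σ x => φ σ x + (if σ = μ then ε else 0) * ex ξ x) z =
      topj r φ z + ε • (ex ξ z • wv r μ ξ) := by
  refine Prod.ext (by simp [topj, wv]) (funext fun q => ?_)
  simp only [topj, wv]
  rw [pdL_add (hφ _) (contDiff_const.mul (ex_smooth ξ)), pdL_smul (ex_smooth ξ), pdL_ex]
  simp only [count_mlist]
  by_cases h : ∑ i, q.2.1 i = r <;> by_cases h' : q.1 = μ <;> simp [h, h']
  exact Or.inl (by ring)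

/-- one exponential perturbation -/
lemma exp_step {n m r : ℕ} {ι : Type*} [Fintype ι] {G : ι → Jet n m r → ℝ} (hG : ∀ i, Sm (G i))
    {c : ι → (Fin n → ℝ) → ℝ} (hc : ∀ i, Continuous (c i)) {S : Set (Fin n → ℝ)}
    (hS : IsCompact S) (hcS : ∀ i, ∀ z ∉ S, c i z = 0) (p : Jet n m r)
    (h : ∀ φ : Fin m → (Fin n → ℝ) → ℝ, (∀ σ, Sm (φ σ)) →
      ∫ z, ∑ i, G i (p + topj r φ z) * c i z = 0) (μ : Fin m) (ξ : Fin n → ℝ) :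
    ∀ φ : Fin m → (Fin n → ℝ) → ℝ, (∀ σ, Sm (φ σ)) →
      ∫ z, ∑ i, fderiv ℝ (G i) (p + topj r φ z) (wv r μ ξ) * (ex ξ z * c i z) = 0 := by
  intro φ hφ
  have ct := (Sm.topj r hφ).continuous
  have ce := (ex_smooth ξ).continuous
  have cp : Continuous (fun w : ℝ × (Fin n → ℝ) =>
      p + topj r φ w.2 + w.1 • (ex ξ w.2 • wv r μ ξ)) := by fun_prop
  have d1 := dui (F := fun ε z => ∑ i, G i (p + topj r φ z + ε • (ex ξ z • wv r μ ξ)) * c i z)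
    (F' := fun ε z => ∑ i, fderiv ℝ (G i) (p + topj r φ z + ε • (ex ξ z • wv r μ ξ))
      (ex ξ z • wv r μ ξ) * c i z)
    (continuous_finsetSum _ fun i _ =>
      ((hG i).continuous.comp cp).mul ((hc i).comp continuous_snd))
    (continuous_finsetSum _ fun i _ =>
      (((hG i).fderiv'.continuous.comp cp).clm_apply (by fun_prop)).mul ((hc i).comp continuous_snd))
    (fun ε z => HasDerivAt.fun_sum fun i _ =>
      (hasDerivAt_line (hG i) (p + topj r φ z) (ex ξ z • wv r μ ξ) ε).mul_const (c i z))
    hS (fun ε z hz => by simp [hcS _ z hz])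
  have h0 : (fun ε : ℝ => ∫ z, ∑ i, G i (p + topj r φ z + ε • (ex ξ z • wv r μ ξ)) * c i z) =
      fun _ => 0 := by
    funext ε
    have := h (fun σ x => φ σ x + (if σ = μ then ε else 0) * ex ξ x) (fun σ =>
      (hφ σ).add (contDiff_const.mul (ex_smooth ξ)))
    simp only [topj_add r hφ] at this
    simpa only [add_assoc] using this
  rw [h0] at d1
  have d2 := d1.unique (hasDerivAt_const _ _)
  rw [← d2]
  refine integral_congr_ae (Filter.Eventually.of_forall fun z => ?_)
  simp only [zero_smul, add_zero, map_smul, smul_eq_mul]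
  exact Finset.sum_congr rfl fun i _ => by ring

lemma exp_list {n m r : ℕ} {ι : Type*} [Fintype ι] {G : ι → Jet n m r → ℝ} (hG : ∀ i, Sm (G i))
    {c : ι → (Fin n → ℝ) → ℝ} (hc : ∀ i, Continuous (c i)) {S : Set (Fin n → ℝ)}
    (hS : IsCompact S) (hcS : ∀ i, ∀ z ∉ S, c i z = 0) (p : Jet n m r)
    (h : ∀ φ : Fin m → (Fin n → ℝ) → ℝ, (∀ σ, Sm (φ σ)) →
      ∫ z, ∑ i, G i (p + topj r φ z) * c i z = 0) (A : List (Fin m × (Fin n → ℝ))) :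
    ∀ φ : Fin m → (Fin n → ℝ) → ℝ, (∀ σ, Sm (φ σ)) →
      ∫ z, ∑ i, ddL (A.map fun a => wv r a.1 a.2) (G i) (p + topj r φ z) *
        (ex (A.map Prod.snd).sum z * c i z) = 0 := by
  induction A with
  | nil => 
    intro φ hφ
    have := h φ hφ
    simpa [ddL, ex] using this
  | cons a A ih =>
    have := exp_step (fun i => (hG i).ddL (A.map fun a => wv r a.1 a.2))
      (c := fun i z => ex (A.map Prod.snd).sum z * c i z)
      (fun i => (ex_smooth _).continuous.mul (hc i)) hS
      (fun i z hz => by rw [hcS i z hz, mul_zero]) p ih a.1 a.2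
    simpa only [List.map_cons, List.sum_cons, ex_add, ddL, mul_assoc] using this

lemma van_list {n m r : ℕ} (hr : 1 ≤ r) {L : Jet n m r → ℝ} {T : Fin m → Jet n m r → ℝ}
    (hL : Sm L) (hT : ∀ σ, Sm (T σ))
    {W : Set (((Fin n) → ℝ) × ((Fin m) → ℝ))} (hW : IsOpen W)
    (hEL : ∀ σ, ∀ p ∈ Dset (n := n) (m := m) (2*r) W,
      EL σ L p = T σ (projJet (by omega : r ≤ 2*r) p))
    (σ ν : Fin m) {p : Jet n m r} (hp : p ∈ Dset r W) (A : List (Fin m × (Fin n → ℝ))) :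
    ddL (A.map (fun a => wv r a.1 a.2) ++ [wv r ν (A.map Prod.snd).sum]) (T σ) p = 0 := by
  classical
  let ψ : ContDiffBump (0 : Fin n → ℝ) := ⟨1/2, 1, by norm_num, by norm_num⟩
  have hψ : Sm (ψ : (Fin n → ℝ) → ℝ) := ψ.contDiff
  have hψs : tsupport (ψ : (Fin n → ℝ) → ℝ) = Metric.closedBall 0 1 := ψ.tsupport_eq
  have hψc : HasCompactSupport (ψ : (Fin n → ℝ) → ℝ) := ψ.hasCompactSupport
  set η := (A.map Prod.snd).sum with hη
  have h1 := exp_list (G := fun K : MD n r => pdY ν K.1 (T σ)) (fun K => (hT σ).pdY _ _)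
    (c := fun K z => if ∑ i, K.1 i = r then pdL (mlist K.1) ψ z else 0)
    (fun K => by
      by_cases hK : ∑ i, K.1 i = r
      · simpa only [hK, if_true] using (hψ.pdL _).continuous
      · simpa only [hK, if_false] using continuous_const)
    hψc (fun K z hz => by rw [pdL_tsupport _ _ _ hz, ite_self]) p
    (fun φ hφ => by
      have := blowup hr hL hT hW hEL σ ν hp hψ hψs.le hφ
      simpa only [mul_ite, mul_zero] using this) A (fun _ _ => 0) (fun _ => contDiff_const)
  have ht : ∀ z, topj (n := n) (m := m) r (fun _ _ => 0) z = 0 := by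
    intro z
    refine Prod.ext rfl (funext fun q => ?_)
    simp [topj, pdL_zero]
  simp only [ht, add_zero, ← hη] at h1
  have hI : 0 < ∫ z, ex η z * ψ z := by
    have hcont : Continuous fun z => ex η z * ψ z := (ex_smooth η).continuous.mul hψ.continuous
    refine hcont.integral_pos_of_hasCompactSupport_nonneg_nonzero (x := 0) hψc.mul_left ?_ ?_
    · intro z; exact mul_nonneg (Real.exp_pos _).le ψ.nonneg
    · have : (ψ : (Fin n → ℝ) → ℝ) 0 = 1 := ψ.one_of_mem_closedBall (by simp [ψ])
      rw [this, mul_one]; exact (Real.exp_pos _).ne'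
  rw [integral_finsetSum] at h1
  · have h2 : ∀ K : MD n r, ∫ z, ddL (A.map fun a => wv r a.1 a.2) (pdY ν K.1 (T σ)) p *
        (ex η z * (if ∑ i, K.1 i = r then pdL (mlist K.1) ψ z else 0)) =
        ((-1)^r * ∫ z, ex η z * ψ z) * ((if ∑ i, K.1 i = r then ∏ i, η i ^ K.1 i else 0) *
          ddL (A.map fun a => wv r a.1 a.2) (pdY ν K.1 (T σ)) p) := by
      intro K
      rw [integral_const_mul]
      by_cases hK : ∑ i, K.1 i = r
      · simp only [hK, if_true]
        rw [ibp (ex_smooth η) hψ hψc, pdL_ex, mlist_length, hK]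
        simp only [count_mlist, mul_assoc, integral_const_mul]
        ring
      · simp [hK]
    simp only [h2] at h1
    rw [← Finset.mul_sum] at h1
    have h3 : ((-1:ℝ)^r * ∫ z, ex η z * ψ z) ≠ 0 := mul_ne_zero (by simp) hI.ne'
    have h4 := (mul_eq_zero.1 h1).resolve_left h3
    have h5 : ddL [wv r ν η] (T σ) = fun p => ∑ K : MD n r,
      (if ∑ i, K.1 i = r then ∏ i, η i ^ K.1 i else 0) * pdY ν K.1 (T σ) p := by
      funext p; exact wv_deriv (T σ) p ν η
    rw [ddL_append, h5, ddL_sum _ (fun K : MD n r => (hT σ).pdY ν K.1)]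
    exact h4
  · intro K _
    refine Integrable.const_mul ?_ _
    by_cases hK : ∑ i, K.1 i = r
    · simp only [hK, if_true]
      exact ((ex_smooth η).continuous.mul (hψ.pdL _).continuous).integrable_of_hasCompactSupport
        (pdL_hcs hψc _).mul_left
    · simp [hK]

lemma van {n m r : ℕ} (hr : 1 ≤ r) {L : Jet n m r → ℝ} {T : Fin m → Jet n m r → ℝ}
    (hL : Sm L) (hT : ∀ σ, Sm (T σ))
    {W : Set (((Fin n) → ℝ) × ((Fin m) → ℝ))} (hW : IsOpen W)
    (hEL : ∀ σ, ∀ p ∈ Dset (n := n) (m := m) (2*r) W,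
      EL σ L p = T σ (projJet (by omega : r ≤ 2*r) p))
    (σ : Fin m) {p : Jet n m r} (hp : p ∈ Dset r W) {k : ℕ} (ν : Fin (k+1) → Fin m)
    (ξ : Fin (k+1) → Fin n → ℝ) (t : Fin (k+1) → ℝ) (ht : ∀ l, t l ≠ 0)
    (hs : ∑ l, t l • ξ l = 0) :
    iteratedFDeriv ℝ (k+1) (T σ) p (fun l => wv r (ν l) (ξ l)) = 0 := by
  let c : Fin (k+1) → ℝ := fun l => if l = Fin.last k then - t l else t l
  have hc : ∀ l, c l ≠ 0 := by
    intro l; simp only [c]; split_ifs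
    · exact neg_ne_zero.2 (ht l)
    · exact ht l
  have hcc : ∀ l : Fin k, c l.castSucc = t l.castSucc := fun l => by
    simp only [c]; rw [if_neg (Fin.castSucc_lt_last l).ne]
  have h1 := van_list hr hL hT hW hEL σ (ν (Fin.last k)) hp
    (List.ofFn fun l : Fin k => (ν l.castSucc, c l.castSucc • ξ l.castSucc))
  have h2 : ((List.ofFn fun l : Fin k => (ν l.castSucc, c l.castSucc • ξ l.castSucc)).map
      Prod.snd).sum = c (Fin.last k) • ξ (Fin.last k) := by
    rw [List.map_ofFn, List.sum_ofFn]
    simp only [Function.comp_def, hcc]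
    rw [Fin.sum_univ_castSucc] at hs
    rw [eq_neg_of_add_eq_zero_left hs]
    simp [c]
  have h3 : (List.ofFn fun l : Fin k => (ν l.castSucc, c l.castSucc • ξ l.castSucc)).map
      (fun a => wv r a.1 a.2) ++ [wv r (ν (Fin.last k)) (c (Fin.last k) • ξ (Fin.last k))] =
      List.ofFn (fun l : Fin (k+1) => (c l)^r • wv r (ν l) (ξ l)) := by
    rw [List.ofFn_succ', List.map_ofFn, List.concat_eq_append]
    simp only [Function.comp_def, wv_smul]
  rw [h2, h3, ddL_ofFn (hT σ), ContinuousMultilinearMap.map_smul_univ, smul_eq_mul] at h1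
  exact (mul_eq_zero.1 h1).resolve_left (Finset.prod_ne_zero_iff.2 fun l _ => pow_ne_zero _ (hc l))

end JetVar


namespace JetVar
open MvPolynomial in
lemma minI_zero (n : ℕ) (P : MvPolynomial (Fin 0 × Fin n) ℝ) : P ∈ minI 0 n := by
  have h : (1 : MvPolynomial (Fin 0 × Fin n) ℝ) ∈ minI 0 n := by
    apply Ideal.subset_span
    refine ⟨Fin.elim0, ?_⟩
    rw [minr]
    simp
  have := (minI 0 n).mul_mem_left P h
  rwa [mul_one] at this

lemma taylor_fin (N : ℕ) : ∀ (h : ℕ → ℝ → ℝ), (∀ k t, HasDerivAt (h k) (h (k+1) t) t) →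
    (∀ t, h N t = 0) → ∀ t, h 0 t = ∑ j ∈ Finset.range N, ((j.factorial : ℕ) : ℝ)⁻¹ * (h j 0 * t^j) := by
  induction N with
  | zero => intro h _ h0 t; simp [h0]
  | succ N ih =>
    intro h hd h0 t
    have h1 := ih (fun k => h (k+1)) (fun k t => hd (k+1) t) h0
    let g : ℝ → ℝ := fun t => h 0 t -
      ∑ j ∈ Finset.range (N+1), ((j.factorial : ℕ) : ℝ)⁻¹ * (h j 0 * t^j)
    have hg : ∀ t, HasDerivAt g 0 t := by
      intro t
      have e1 : HasDerivAt (fun t : ℝ => ∑ j ∈ Finset.range (N+1),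
          ((j.factorial : ℕ) : ℝ)⁻¹ * (h j 0 * t^j))
          (∑ j ∈ Finset.range (N+1), ((j.factorial : ℕ) : ℝ)⁻¹ * (h j 0 * ((j:ℝ) * t^(j-1)))) t :=
        HasDerivAt.fun_sum fun j _ => ((hasDerivAt_pow j t).const_mul _).const_mul _
      have e2 := (hd 0 t).sub e1
      have e3 : h (0+1) t - ∑ j ∈ Finset.range (N+1),
          ((j.factorial : ℕ) : ℝ)⁻¹ * (h j 0 * ((j:ℝ) * t^(j-1))) = 0 := by
        rw [Finset.sum_range_succ', sub_eq_zero]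
        have := h1 t
        rw [this]
        simp only [Nat.cast_zero, zero_mul, mul_zero, add_zero]
        refine Finset.sum_congr rfl fun j _ => ?_
        rw [Nat.factorial_succ]
        have : (j.factorial : ℝ) ≠ 0 := by positivity
        have : ((j:ℝ)+1) ≠ 0 := by positivity
        push_cast
        field_simp
      rw [e3] at e2
      exact e2
    have hc := is_const_of_deriv_eq_zero (fun t => (hg t).differentiableAt) (fun t => (hg t).deriv) t 0
    have h00 : g 0 = 0 := by
      simp only [g]
      rw [Finset.sum_range_succ']
      simp
    rw [h00] at hc
    exact sub_eq_zero.1 hc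

lemma multi_expand {E ι : Type*} [NormedAddCommGroup E] [NormedSpace ℝ E] [Fintype ι]
    [DecidableEq ι] {s : ℕ}
    (M : ContinuousMultilinearMap ℝ (fun _ : Fin s => E) ℝ) (c : Fin s → ι → ℝ) (e : Fin s → ι → E) :
    M (fun l => ∑ a, c l a • e l a) =
      ∑ Q : Fin s → ι, (M fun l => e l (Q l)) * ∏ l, c l (Q l) := by
  rw [ContinuousMultilinearMap.map_sum]
  refine Finset.sum_congr rfl fun Q _ => ?_
  rw [ContinuousMultilinearMap.map_smul_univ, smul_eq_mul, mul_comm]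

/-- coordinate direction -/
noncomputable def ej {n m r : ℕ} (ν : Fin m) (J : MD n r) : Jet n m r :=
  (0, Pi.single (ν, J) 1)

/-- Taylor coefficients in the top-order directions -/
noncomputable def Bc {n m r : ℕ} (T : Jet n m r → ℝ) (s : ℕ) (ν : Fin s → Fin m) (p : Jet n m r)
    (J : Fin s → MD n r) : ℝ :=
  if ∀ l, ∑ i, (J l).1 i = r then iteratedFDeriv ℝ s T p (fun l => ej (ν l) (J l)) else 0

lemma Bc_zero {n m r : ℕ} (T : Jet n m r → ℝ) (s : ℕ) (ν : Fin s → Fin m) (p : Jet n m r)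
    (J : Fin s → MD n r) (l : Fin s) (h : ∑ i, (J l).1 i ≠ r) : Bc T s ν p J = 0 := by
  rw [Bc, if_neg]; intro h'; exact h (h' l)

lemma Bc_ite {n m r : ℕ} (T : Jet n m r → ℝ) (s : ℕ) (ν : Fin s → Fin m) (p : Jet n m r)
    (J : Fin s → MD n r) (c : Fin s → ℝ) :
    iteratedFDeriv ℝ s T p (fun l => ej (ν l) (J l)) *
      ∏ l, (if ∑ i, (J l).1 i = r then c l else 0) = Bc T s ν p J * ∏ l, c l := by
  by_cases h : ∀ l, ∑ i, (J l).1 i = r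
  · rw [Bc, if_pos h]; simp [h]
  · rw [Bc, if_neg h, zero_mul]
    push Not at h
    obtain ⟨l, hl⟩ := h
    rw [Finset.prod_eq_zero (Finset.mem_univ l) (if_neg hl), mul_zero]

lemma D_wv {n m r : ℕ} (T : Jet n m r → ℝ) (s : ℕ) (ν : Fin s → Fin m) (p : Jet n m r)
    (ξ : Fin s → Fin n → ℝ) : iteratedFDeriv ℝ s T p (fun l => wv r (ν l) (ξ l)) =
      ∑ J : Fin s → MD n r, Bc T s ν p J * ∏ l, ∏ i, ξ l i ^ (J l).1 i := by
  classical
  have h1 : ∀ l, wv r (ν l) (ξ l) = ∑ J : MD n r,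
      (if ∑ i, J.1 i = r then ∏ i, ξ l i ^ J.1 i else 0) • ej (ν l) J := by
    intro l
    refine Prod.ext (by simp [wv, ej, Prod.fst_sum, -ite_smul]) (funext fun q => ?_)
    obtain ⟨μ, K⟩ := q
    simp only [wv, ej, Prod.snd_sum, Finset.sum_apply, Prod.smul_snd, Pi.smul_apply, smul_eq_mul,
      Pi.single_apply, Prod.mk.injEq]
    rw [Finset.sum_eq_single K]
    · by_cases h : μ = ν l <;> simp [h]
    · intro J _ hJ; simp [hJ.symm]
    · simp
  simp only [h1]
  rw [multi_expand]
  exact Finset.sum_congr rfl fun J _ => Bc_ite T s ν p J _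

lemma D_top {n m r : ℕ} (T : Jet n m r → ℝ) (s : ℕ) (p v q : Jet n m r)
    (hv : v = ∑ a : JIdx n m r, (if ∑ i, a.2.1 i = r then q.2 a else 0) • ej a.1 a.2) :
    iteratedFDeriv ℝ s T p (fun _ => v) =
      ∑ ν : Fin s → Fin m, ∑ J : Fin s → MD n r,
        Bc T s ν p J * ∏ l, yc (ν l) (J l).1 q := by
  classical
  rw [hv, multi_expand, ← (Equiv.arrowProdEquivProdArrow (Fin s) (fun _ => Fin m)
    (fun _ => MD n r)).symm.sum_comp, Fintype.sum_prod_type]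
  refine Finset.sum_congr rfl fun ν _ => Finset.sum_congr rfl fun J _ => ?_
  have := Bc_ite T s ν p J (fun l => q.2 (ν l, J l))
  simp only [yc]
  have h2 : ∀ l, (if h : ∑ i, (J l).1 i ≤ r then q.2 (ν l, ⟨(J l).1, h⟩) else 0) = q.2 (ν l, J l) :=
    fun l => dif_pos (J l).2
  simp only [h2]
  rw [← this]
  rfl

/-- zero section of the top-order fibration -/
noncomputable def emb {n m r : ℕ} (b : Jet n m (r-1)) : Jet n m r :=
  (b.1, fun q => if h : ∑ i, q.2.1 i ≤ r - 1 then b.2 (q.1, ⟨q.2.1, h⟩) else 0)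

lemma emb_smooth {n m r : ℕ} : Sm (emb : Jet n m (r-1) → Jet n m r) := by
  refine contDiff_fst.prodMk (contDiff_pi.2 fun q => ?_)
  by_cases h : ∑ i, q.2.1 i ≤ r - 1
  · simp only [h, dif_pos]
    exact (contDiff_apply ℝ ℝ _).comp contDiff_snd
  · simp only [h, dif_neg, not_false_iff]; exact contDiff_const

lemma emb_mem {n m r : ℕ} (W : Set (((Fin n) → ℝ) × ((Fin m) → ℝ))) (b : Jet n m (r-1)) :
    emb b ∈ Dset r W ↔ b ∈ Dset (r-1) W := by
  have : (fun σ => yc σ (fun _ => 0) (emb b : Jet n m r)) = fun σ => yc σ (fun _ => 0) b := by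
    funext σ
    simp [yc, emb]
  simp only [Dset, Set.mem_ofPred_eq, this]
  rfl

lemma emb_add {n m r : ℕ} (hr : 1 ≤ r) (p : Jet n m r) :
    p = emb (projJet (Nat.sub_le r 1) p) +
      ∑ a : JIdx n m r, (if ∑ i, a.2.1 i = r then p.2 a else 0) • ej a.1 a.2 := by
  classical
  refine Prod.ext (by simp [emb, projJet, ej, Prod.fst_sum, -ite_smul]) (funext fun q => ?_)
  simp only [Prod.snd_add, Pi.add_apply, Prod.snd_sum, Finset.sum_apply, Prod.smul_snd,
    Pi.smul_apply, smul_eq_mul, ej]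
  rw [Finset.sum_eq_single q]
  · have := q.2.2
    by_cases h : ∑ i, q.2.1 i = r
    · have h' : ¬ ∑ i, q.2.1 i ≤ r - 1 := by omega
      simp [emb, h, h']
      omega
    · have h' : ∑ i, q.2.1 i ≤ r - 1 := by omega
      simp [emb, h, h', projJet]
  · intro a _ ha
    have : q ≠ (a.1, a.2) := ha.symm
    simp [Pi.single_apply, this]
  · simp

lemma shift_mem {n m r : ℕ} (hr : 1 ≤ r) (W : Set (((Fin n) → ℝ) × ((Fin m) → ℝ)))
    (p : Jet n m r) (c : JIdx n m r → ℝ) (t : ℝ) :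
    p + t • ∑ a : JIdx n m r, (if ∑ i, a.2.1 i = r then c a else 0) • ej a.1 a.2 ∈ Dset r W ↔
      p ∈ Dset r W := by
  classical
  set q := p + t • ∑ a : JIdx n m r, (if ∑ i, a.2.1 i = r then c a else 0) • ej a.1 a.2 with hq
  have h1 : q.1 = p.1 := by simp [hq, ej, Prod.fst_sum, -ite_smul]
  have h2 : (fun σ => yc σ (fun _ => 0) q) = fun σ => yc σ (fun _ => 0) p := by
    funext σ
    simp only [yc, Finset.sum_const_zero, Nat.zero_le, dif_pos, hq, Prod.snd_add, Pi.add_apply,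
      Prod.smul_snd, Pi.smul_apply, Prod.snd_sum, Finset.sum_apply, smul_eq_mul, ej]
    rw [add_eq_left, Finset.sum_eq_zero, mul_zero]
    intro a _
    by_cases h : ∑ i, a.2.1 i = r
    · have : ((σ, ⟨fun _ => 0, by simp⟩) : JIdx n m r) ≠ (a.1, a.2) := by
        intro h'
        have h3 : (⟨fun _ => 0, by simp⟩ : MD n r) = a.2 := congrArg Prod.snd h'
        rw [← h3] at h
        simp at h
        omega
      simp [Pi.single_apply, this]
    · simp [h]
  simp only [Dset, Set.mem_ofPred_eq, h1, h2]

/-- The core theorem for globally smooth data. -/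
theorem core {n m r : ℕ} (hr : 1 ≤ r) {L : Jet n m r → ℝ} {T : Fin m → Jet n m r → ℝ}
    (hL : Sm L) (hT : ∀ σ, Sm (T σ))
    {W : Set (((Fin n) → ℝ) × ((Fin m) → ℝ))} (hW : IsOpen W)
    (hEL : ∀ σ, ∀ p ∈ Dset (n := n) (m := m) (2*r) W,
      EL σ L p = T σ (projJet (by omega : r ≤ 2*r) p)) (σ : Fin m) :
    ∃ C : CoefFam n m r, IsAltSymC C ∧ (∀ s I σs iv, ContDiff ℝ (⊤:ℕ∞) (C s I σs iv)) ∧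
      ∀ p ∈ Dset (n := n) (m := m) r W, T σ p = LagC C p := by
  have hmem : ∀ k (ν : Fin (k+1) → Fin m), ∀ p ∈ Dset (n := n) (m := m) r W,
      polyB (Bc (T σ) (k+1) ν p) ∈ minI (k+1) n := by
    intro k ν p hp
    refine mem_minI _ _ (fun _ => r) rfl (MHom_polyB _ fun J l h => Bc_zero _ _ _ _ _ l h) ?_
    intro ξ t ht hs
    rw [eval_polyB, ← D_wv]
    exact van hr hL hT hW hEL σ hp ν ξ t ht hs
  refine assemble hr W (T σ) (fun s ν b J => Bc (T σ) s ν (emb b) J) ?_ ?_ ?_ ?_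
  · intro s ν J
    by_cases h : ∀ l, ∑ i, (J l).1 i = r
    · simp only [Bc, if_pos h, ← ddL_ofFn (hT σ)]
      exact ((hT σ).ddL _).comp emb_smooth
    · simp only [Bc, if_neg h]; exact contDiff_const
  · intro s ν b J l h
    exact Bc_zero _ _ _ _ _ l h
  · intro s _ ν b hb
    rcases s with _ | k
    · exact minI_zero _ _
    · exact hmem k ν (emb b) ((emb_mem W b).2 hb)
  · intro p hp
    set b := projJet (Nat.sub_le r 1) p with hb
    set v : Jet n m r := ∑ a : JIdx n m r, (if ∑ i, a.2.1 i = r then p.2 a else 0) • ej a.1 a.2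
      with hv
    have hpe : p = emb b + v := emb_add hr p
    have hbm : emb b ∈ Dset r W := by
      have := (shift_mem hr W (emb b) p.2 1)
      rw [← hv, one_smul, ← hpe] at this
      exact this.1 hp
    have ht := taylor_fin (n+1) (fun k t => ddL (List.replicate k v) (T σ) (emb b + t • v))
      (fun k t => hasDerivAt_line ((hT σ).ddL _) (emb b) v t) (fun t => by
        have hz : Bc (T σ) (n+1) = fun ν q J => Bc (T σ) (n+1) ν q J := rfl
        simp only [← List.ofFn_const, ddL_ofFn (hT σ)]
        rw [D_top (T σ) (n+1) _ v p hv]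
        refine Finset.sum_eq_zero fun ν _ => Finset.sum_eq_zero fun J _ => ?_
        rw [polyB_big _ (hmem n ν _ ((shift_mem hr W (emb b) p.2 t).2 hbm))]
        simp) 1
    simp only [List.replicate_zero, ddL, one_smul, ← hpe, one_pow, mul_one, zero_smul, add_zero] at ht
    rw [ht, Finset.sum_range]
    refine Finset.sum_congr rfl fun s _ => ?_
    congr 1
    rw [← List.ofFn_const, ddL_ofFn (hT σ)]
    exact D_top (T σ) s _ v p hv

end JetVar


namespace JetVar

/-- projection to the total space -/
def ptot {n m : ℕ} (t : ℕ) (p : Jet n m t) : ((Fin n) → ℝ) × ((Fin m) → ℝ) :=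
  (p.1, fun σ => yc σ (fun _ => 0) p)

lemma ptot_smooth {n m : ℕ} (t : ℕ) : Sm (ptot t : Jet n m t → _) :=
  contDiff_fst.prodMk (contDiff_pi.2 fun σ => Sm.yc σ _)

lemma Dset_open {n m : ℕ} (t : ℕ) {W : Set (((Fin n) → ℝ) × ((Fin m) → ℝ))} (hW : IsOpen W) :
    IsOpen (Dset t W) := hW.preimage (ptot_smooth t).continuous

lemma projJet_mem {n m s t : ℕ} (h : s ≤ t) {W : Set (((Fin n) → ℝ) × ((Fin m) → ℝ))}
    {p : Jet n m t} (hp : p ∈ Dset t W) : projJet h p ∈ Dset s W := by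
  have : (fun σ => yc σ (fun _ => 0) (projJet h p)) = fun σ => yc σ (fun _ => 0) p := by
    funext σ
    simp [yc, projJet]
  simp only [Dset, Set.mem_ofPred_eq, this] at hp ⊢
  exact hp

lemma fderiv_agree {n m t : ℕ} {W : Set (((Fin n) → ℝ) × ((Fin m) → ℝ))} (hW : IsOpen W)
    {f g : Jet n m t → ℝ} (h : ∀ p ∈ Dset t W, f p = g p) (p : Jet n m t) (hp : p ∈ Dset t W) :
    fderiv ℝ f p = fderiv ℝ g p := by
  apply Filter.EventuallyEq.fderiv_eq
  filter_upwards [(Dset_open t hW).mem_nhds hp] with q hq using h q hq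

lemma pdY_agree {n m t : ℕ} {W : Set (((Fin n) → ℝ) × ((Fin m) → ℝ))} (hW : IsOpen W)
    {f g : Jet n m t → ℝ} (h : ∀ p ∈ Dset t W, f p = g p) (σ : Fin m) (J : Fin n → ℕ) :
    ∀ p ∈ Dset t W, pdY σ J f p = pdY σ J g p := by
  intro p hp
  simp only [pdY, fderiv_agree hW h p hp]

lemma formalD_agree {n m t : ℕ} {W : Set (((Fin n) → ℝ) × ((Fin m) → ℝ))} (hW : IsOpen W)
    {f g : Jet n m t → ℝ} (h : ∀ p ∈ Dset t W, f p = g p) (i : Fin n) :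
    ∀ p ∈ Dset (t+1) W, formalD i f p = formalD i g p := by
  intro p hp
  have hq := projJet_mem (Nat.le_succ t) hp
  simp only [formalD, pdX, pdY, fderiv_agree hW h _ hq]

lemma formalDL_agree {n m t : ℕ} {W : Set (((Fin n) → ℝ) × ((Fin m) → ℝ))} (hW : IsOpen W)
    {f g : Jet n m t → ℝ} (h : ∀ p ∈ Dset t W, f p = g p) (l : List (Fin n)) :
    ∀ p ∈ Dset (t + l.length) W, formalDL l f p = formalDL l g p := by
  induction l with
  | nil => exact h
  | cons i l ih => exact formalD_agree hW ih i

lemma EL_agree {n m r : ℕ} {W : Set (((Fin n) → ℝ) × ((Fin m) → ℝ))} (hW : IsOpen W)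
    {f g : Jet n m r → ℝ} (h : ∀ p ∈ Dset r W, f p = g p) (σ : Fin m) :
    ∀ p ∈ Dset (2*r) W, EL σ f p = EL σ g p := by
  intro p hp
  simp only [EL, LieEuler]
  refine Finset.sum_congr rfl fun J _ => ?_
  split_ifs with h'
  · congr 1
    simp only [formalDI]
    exact formalDL_agree hW (pdY_agree hW h σ _) _ _ (projJet_mem _ (projJet_mem _ hp))
  · rfl

lemma cutoff_smooth {n m t : ℕ} {W : Set (((Fin n) → ℝ) × ((Fin m) → ℝ))} (hW : IsOpen W)
    {f : Jet n m t → ℝ} (hf : ContDiffOn ℝ (⊤:ℕ∞) f (Dset t W))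
    {ρ : ((Fin n) → ℝ) × ((Fin m) → ℝ) → ℝ} (hρ : Sm ρ) (hs : tsupport ρ ⊆ W) :
    Sm (fun p => ρ (ptot t p) * f p) := by
  rw [Sm, contDiff_iff_contDiffAt]
  intro p
  by_cases hp : ptot t p ∈ W
  · exact ((hρ.comp (ptot_smooth t)).contDiffAt).mul
      (hf.contDiffAt ((Dset_open t hW).mem_nhds hp))
  · have h1 : ptot t p ∈ (tsupport ρ)ᶜ := fun h => hp (hs h)
    have h2 : ∀ᶠ q in nhds p, ptot t q ∈ (tsupport ρ)ᶜ :=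
      (ptot_smooth t).continuous.continuousAt.eventually_mem
        ((isClosed_tsupport ρ).isOpen_compl.mem_nhds h1)
    refine (contDiffAt_const (c := (0:ℝ))).congr_of_eventuallyEq ?_
    filter_upwards [h2] with q hq
    rw [image_eq_zero_of_notMem_tsupport hq, zero_mul]

theorem main_aux (n m r : ℕ) (hr : 1 ≤ r)
    (W : Set (((Fin n) → ℝ) × ((Fin m) → ℝ)))
    (T : Fin m → Jet n m r → ℝ)
    (hTs : ∀ σ, ContDiffOn ℝ (⊤:ℕ∞) (T σ) (Dset r W))
    (hvar : ∀ z ∈ W, ∃ W' : Set (((Fin n) → ℝ) × ((Fin m) → ℝ)),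
      IsOpen W' ∧ z ∈ W' ∧ W' ⊆ W ∧
      ∃ L : Jet n m r → ℝ, ContDiffOn ℝ (⊤:ℕ∞) L (Dset r W') ∧
        ∀ σ : Fin m, ∀ p ∈ Dset (n := n) (m := m) (2*r) W',
          EL σ L p = T σ (projJet (by omega : r ≤ 2*r) p)) :
    ∀ z ∈ W, ∃ W'' : Set (((Fin n) → ℝ) × ((Fin m) → ℝ)),
      IsOpen W'' ∧ z ∈ W'' ∧ W'' ⊆ W ∧
      ∃ 𝒯 : Fin m → CoefFam n m r,
        (∀ σ, IsAltSymC (𝒯 σ)) ∧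
        (∀ σ s I σs iv, ContDiffOn ℝ (⊤:ℕ∞) ((𝒯 σ) s I σs iv) (Dset (r-1) W'')) ∧
        ∀ σ : Fin m, ∀ p ∈ Dset (n := n) (m := m) r W'', T σ p = LagC (𝒯 σ) p := by
  intro z hz
  obtain ⟨W', hW', hzW', hsub, L, hLs, hEL⟩ := hvar z hz
  obtain ⟨ε, hε, hball⟩ := Metric.isOpen_iff.1 hW' z hzW'
  let ρ : ContDiffBump z := ⟨ε/4, ε/2, by linarith, by linarith⟩
  have hρ : Sm (ρ : ((Fin n) → ℝ) × ((Fin m) → ℝ) → ℝ) := ρ.contDiff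
  have hρs : tsupport (ρ : ((Fin n) → ℝ) × ((Fin m) → ℝ) → ℝ) ⊆ W' := by
    rw [ρ.tsupport_eq]
    exact (Metric.closedBall_subset_ball (by simp only [ρ]; linarith)).trans hball
  have hsubT : ∀ t, Dset (n := n) (m := m) t W' ⊆ Dset t W := fun t p hp => hsub hp
  have hB : Metric.ball z (ε/4) ⊆ W' := (Metric.ball_subset_ball (by linarith)).trans hball
  have hone : ∀ t, ∀ p ∈ Dset (n := n) (m := m) t (Metric.ball z (ε/4)), ρ (ptot t p) = 1 :=
    fun t p hp => ρ.one_of_mem_closedBall (Metric.ball_subset_closedBall hp)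
  have hc := core (r := r) hr (L := fun p => ρ (ptot r p) * L p)
    (T := fun σ p => ρ (ptot r p) * T σ p)
    (cutoff_smooth hW' hLs hρ hρs)
    (fun σ => cutoff_smooth hW' ((hTs σ).mono (hsubT r)) hρ hρs)
    (W := Metric.ball z (ε/4)) Metric.isOpen_ball (fun σ p hp => by
      rw [EL_agree Metric.isOpen_ball (g := L) (fun q hq => by rw [hone r q hq, one_mul]) σ p hp,
        hEL σ p (hB hp), hone r _ (projJet_mem _ hp), one_mul])
  choose C hC1 hC2 hC3 using hc
  refine ⟨Metric.ball z (ε/4), Metric.isOpen_ball, Metric.mem_ball_self (by linarith),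
    hB.trans hsub, C, hC1, fun σ s I σs iv => (hC2 σ s I σs iv).contDiffOn, ?_⟩
  intro σ p hp
  rw [← hC3 σ p hp, hone r p hp, one_mul]

end JetVar

namespace JetVar

/-- locally variational source expressions of order `r` are, locally,
hyper-Jacobian polynomials in the highest-order derivatives. -/
theorem locally_variational_hyperJacobian_structure (n m r : ℕ)
    (hn : 1 ≤ n) (hm : 1 ≤ m) (hr : 1 ≤ r)
    (W : Set (((Fin n) → ℝ) × ((Fin m) → ℝ))) (hW : IsOpen W)
    (T : Fin m → Jet n m r → ℝ)
    (hTs : ∀ σ, ContDiffOn ℝ (⊤:ℕ∞) (T σ) (Dset r W))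
    (hvar : ∀ z ∈ W, ∃ W' : Set (((Fin n) → ℝ) × ((Fin m) → ℝ)),
      IsOpen W' ∧ z ∈ W' ∧ W' ⊆ W ∧
      ∃ L : Jet n m r → ℝ, ContDiffOn ℝ (⊤:ℕ∞) L (Dset r W') ∧
        ∀ σ : Fin m, ∀ p ∈ Dset (n := n) (m := m) (2*r) W',
          EL σ L p = T σ (projJet (by omega : r ≤ 2*r) p)) :
    ∀ z ∈ W, ∃ W'' : Set (((Fin n) → ℝ) × ((Fin m) → ℝ)),
      IsOpen W'' ∧ z ∈ W'' ∧ W'' ⊆ W ∧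
      ∃ 𝒯 : Fin m → CoefFam n m r,
        (∀ σ, IsAltSymC (𝒯 σ)) ∧
        (∀ σ s I σs iv, ContDiffOn ℝ (⊤:ℕ∞) ((𝒯 σ) s I σs iv) (Dset (r-1) W'')) ∧
        ∀ σ : Fin m, ∀ p ∈ Dset (n := n) (m := m) r W'', T σ p = LagC (𝒯 σ) p := by
  exact main_aux n m r hr W T hTs hvar

end JetVar
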